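/- arXiv:2503.05506 — 4 statements merged into one kernel-verified Lean document; each statement's English description precedes it below -/
import Mathlib

section
/- For every integer k ≥ 3, setting n = 6k² − 5k, there exists an edge-pancyclic graph of order n with exactly 2n − k edges. -/
/-- The edge `e` lies in a cycle of length `k` in the graph `G`. -/
def SimpleGraph.EdgeInCycleOfLength {V : Type*} (G : SimpleGraph V) (e : Sym2 V) (k : ℕ) : Prop :=
  ∃ (v : V) (c : G.Walk v v), c.IsCycle ∧ c.length = k ∧ e ∈ c.edges

/-- A graph `G` of order `n` is edge-pancyclic if for every `k` with `3 ≤ k ≤ n`,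
every edge of `G` lies in a cycle of length `k`. -/
def SimpleGraph.EdgePancyclic {V : Type*} [Fintype V] (G : SimpleGraph V) : Prop :=
  ∀ k : ℕ, 3 ≤ k → k ≤ Fintype.card V → ∀ e ∈ G.edgeSet, G.EdgeInCycleOfLength e k

/-- A graph `G` is `k`-edge-proper if every edge of `G` lies in a cycle of length `i`
for every `3 ≤ i ≤ k`, and every edge of `G` lies in a Hamilton cycle of `G`. -/
def SimpleGraph.EdgeProper {V : Type*} [Fintype V] [DecidableEq V]
    (G : SimpleGraph V) (k : ℕ) : Prop :=
  ∀ e ∈ G.edgeSet,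
    (∀ i : ℕ, 3 ≤ i → i ≤ k → G.EdgeInCycleOfLength e i) ∧
    ∃ (v : V) (c : G.Walk v v), c.IsHamiltonianCycle ∧ e ∈ c.edges

namespace BlockRing

open SimpleGraph

/-- Adjacency `a ~ b` with `a < b` in a block: `0` and `1` are the two hubs, which are adjacent,
the even vertices `2, 4, …` form a path joined to hub `0`, the odd vertices `3, 5, …` form a path
joined to hub `1`, and `0 ~ 3`, `1 ~ 2`. -/
def Arc (a b : ℕ) : Prop :=
  a < b ∧ (b = a + 2 ∨ a ≤ 1 ∧ (b ≤ 3 ∨ a % 2 = b % 2))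

/-- Adjacency in a block. -/
def BlockAdj (a b : ℕ) : Prop := Arc a b ∨ Arc b a

/-- The automorphism of the block exchanging the two hubs and the two paths. -/
def mirror (v : ℕ) : ℕ := if v % 2 = 0 then v + 1 else v - 1

lemma mirror_mirror (v : ℕ) : mirror (mirror v) = v := by
  unfold mirror; grind

lemma mirror_injective : Function.Injective mirror :=
  Function.LeftInverse.injective mirror_mirror

lemma BlockAdj.symm {a b : ℕ} (h : BlockAdj a b) : BlockAdj b a := Or.symm h

lemma BlockAdj.mirror {a b : ℕ} (h : BlockAdj a b) :
    BlockAdj (mirror a) (mirror b) := by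
  unfold BlockAdj Arc BlockRing.mirror at *
  split_ifs <;> omega

/-- `c 0, …, c L` is a walk in the block with largest vertex `2 * f + 3`. -/
structure IsBlockWalk (f : ℕ) (c : ℕ → ℕ) (L : ℕ) : Prop where
  le : ∀ j ≤ L, c j ≤ 2 * f + 3
  adj : ∀ j < L, BlockAdj (c j) (c (j + 1))

/-- `c` traverses the edge `ab` within its first `L` steps. -/
def Traverses (c : ℕ → ℕ) (L a b : ℕ) : Prop :=
  ∃ j < L, c j = a ∧ c (j + 1) = b ∨ c j = b ∧ c (j + 1) = a

/-- The block has a cycle of length `L` through `ab`. -/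
def HasCycle (f a b L : ℕ) : Prop :=
  ∃ c : ℕ → ℕ, IsBlockWalk f c L ∧ (∀ i j, 1 ≤ i → i < j → j ≤ L → c i ≠ c j) ∧
    c 0 = c L ∧ Traverses c L a b

/-- The block has a path of length `L` through `ab` between its two terminals
`2 * f + 3` and `2 * f + 2`. -/
def HasPath (f a b L : ℕ) : Prop :=
  ∃ c : ℕ → ℕ, IsBlockWalk f c L ∧ (∀ i j, i < j → j ≤ L → c i ≠ c j) ∧
    c 0 = 2 * f + 3 ∧ c L = 2 * f + 2 ∧ Traverses c L a b

lemma HasCycle.mirror {f a b L : ℕ} (h : HasCycle f a b L) :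
    HasCycle f (mirror a) (mirror b) L := by
  obtain ⟨c, ⟨hle, hadj⟩, hinj, h0, j, hj, hab⟩ := h
  refine ⟨fun i => BlockRing.mirror (c i), ⟨fun i hi => ?_, fun i hi => (hadj i hi).mirror⟩,
    fun i j h1 h2 h3 h => hinj i j h1 h2 h3 (mirror_injective h), by simp [h0], j, hj, ?_⟩
  · have := hle i hi
    simp only [BlockRing.mirror]
    split_ifs <;> omega
  · rcases hab with ⟨h, h'⟩ | ⟨h, h'⟩ <;> simp [h, h']

lemma HasPath.mirror {f a b L : ℕ} (h : HasPath f a b L) :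
    HasPath f (mirror a) (mirror b) L := by
  obtain ⟨c, ⟨hle, hadj⟩, hinj, h0, hL, j, hj, hab⟩ := h
  refine ⟨fun i => BlockRing.mirror (c (L - i)), ⟨fun i hi => ?_, fun i hi => ?_⟩,
    fun i j h2 h3 h => hinj (L - j) (L - i) (by omega) (by omega) (mirror_injective h).symm,
    ?_, ?_, L - (j + 1), by omega, ?_⟩
  · have := hle (L - i) (by omega)
    simp only [BlockRing.mirror]
    split_ifs <;> omega
  · have := (hadj (L - (i + 1)) (by omega)).mirror.symm
    rwa [show L - (i + 1) + 1 = L - i by omega] at this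
  · simp only [BlockRing.mirror, Nat.sub_zero, hL]; split_ifs <;> omega
  · simp only [BlockRing.mirror, Nat.sub_self, h0]; split_ifs <;> omega
  · simp only [show L - (L - (j + 1)) = j + 1 by omega,
      show L - (L - (j + 1) + 1) = j by omega]
    rcases hab with ⟨h, h'⟩ | ⟨h, h'⟩ <;> simp [h, h']

/-- The cycle through hub `0` and the even vertices `2 * y + 2, …, 2 * x + 2`. -/
lemma fan_cycle {f x y a b : ℕ} (hyx : y < x) (hx : x ≤ f)
    (hab : a = 0 ∧ b = 2 * x + 2 ∨ a = 0 ∧ b = 2 * y + 2 ∨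
      ∃ z, y ≤ z ∧ z < x ∧ a = 2 * z + 2 ∧ b = 2 * z + 4) :
    HasCycle f a b (x - y + 2) := by
  refine ⟨fun j => if j < 1 then 0 else if j ≤ x - y + 1 then 2 * (y + j) else 0,
    ⟨?_, ?_⟩, ?_, ?_, ?_⟩
  · intro j hj
    split_ifs <;> omega
  · intro j hj
    unfold BlockAdj Arc
    split_ifs <;> omega
  · intro i j h1 h2 h3
    beta_reduce
    split_ifs <;> omega
  · dsimp only
    split_ifs <;> omega
  · rcases hab with h | h | ⟨z, h⟩
    · refine ⟨x - y + 1, by omega, ?_⟩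
      beta_reduce
      split_ifs <;> omega
    · refine ⟨0, by omega, ?_⟩
      beta_reduce
      split_ifs <;> omega
    · refine ⟨z - y + 1, by omega, ?_⟩
      beta_reduce
      split_ifs <;> omega

/-- The cycle through both hubs and the even vertices `2, …, 2 * x + 2`. -/
lemma hub_cycle {f x a b : ℕ} (hx : x ≤ f)
    (hab : a = 0 ∧ b = 2 * x + 2 ∨ a = 0 ∧ b = 1 ∨ a = 1 ∧ b = 2 ∨
      ∃ z < x, a = 2 * z + 2 ∧ b = 2 * z + 4) :
    HasCycle f a b (x + 3) := by
  refine ⟨fun j => if j < 1 then 0 else if j = 1 then 1 else if j ≤ x + 2 then 2 * (j - 1) else 0,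
    ⟨?_, ?_⟩, ?_, ?_, ?_⟩
  · intro j hj
    split_ifs <;> omega
  · intro j hj
    unfold BlockAdj Arc
    split_ifs <;> omega
  · intro i j h1 h2 h3
    beta_reduce
    split_ifs <;> omega
  · dsimp only
    split_ifs <;> omega
  · rcases hab with h | h | h | ⟨z, h⟩
    · refine ⟨x + 2, by omega, ?_⟩
      beta_reduce
      split_ifs <;> omega
    · refine ⟨0, by omega, ?_⟩
      beta_reduce
      split_ifs <;> omega
    · refine ⟨1, by omega, ?_⟩
      beta_reduce
      split_ifs <;> omega
    · refine ⟨z + 2, by omega, ?_⟩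
      beta_reduce
      split_ifs <;> omega

/-- The cycle through `0, 3, 5, …, 2 * y + 3, 1, 2, 4, …, 2 * x + 2`. -/
lemma double_cycle {f x y a b : ℕ} (hx : x ≤ f) (hy : y ≤ f)
    (hab : a = 0 ∧ b = 2 * x + 2 ∨ a = 1 ∧ b = 2 ∨
      ∃ z < x, a = 2 * z + 2 ∧ b = 2 * z + 4) :
    HasCycle f a b (x + y + 4) := by
  refine ⟨fun j => if j < 1 then 0 else if j ≤ y + 1 then 2 * j + 1 else if j = y + 2 then 1 else
      if j ≤ x + y + 3 then 2 * (j - (y + 2)) else 0,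
    ⟨?_, ?_⟩, ?_, ?_, ?_⟩
  · intro j hj
    split_ifs <;> omega
  · intro j hj
    unfold BlockAdj Arc
    split_ifs <;> omega
  · intro i j h1 h2 h3
    beta_reduce
    split_ifs <;> omega
  · dsimp only
    split_ifs <;> omega
  · rcases hab with h | h | ⟨z, h⟩
    · refine ⟨x + y + 3, by omega, ?_⟩
      beta_reduce
      split_ifs <;> omega
    · refine ⟨y + 2, by omega, ?_⟩
      beta_reduce
      split_ifs <;> omega
    · refine ⟨y + z + 3, by omega, ?_⟩
      beta_reduce
      split_ifs <;> omega

/-- The path through `2 * f + 3, …, 2 * z + 3, 1, 0, 2 * y + 2, …, 2 * f + 2`. -/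
lemma short_path {f y z a b : ℕ} (hy : y ≤ f) (hz : z ≤ f)
    (hab : a = 0 ∧ b = 1 ∨ ∃ x, y ≤ x ∧ x < f ∧ a = 2 * x + 2 ∧ b = 2 * x + 4) :
    HasPath f a b ((f - z) + 3 + (f - y)) := by
  refine ⟨fun j => if j ≤ f - z then 2 * (f - j) + 3 else if j = f - z + 1 then 1 else
      if j = f - z + 2 then 0 else 2 * (y + (j - (f - z + 3))) + 2,
    ⟨?_, ?_⟩, ?_, ?_, ?_, ?_⟩
  · intro j hj
    split_ifs <;> omega
  · intro j hj
    unfold BlockAdj Arc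
    split_ifs <;> omega
  · intro i j h2 h3
    beta_reduce
    split_ifs <;> omega
  · dsimp only
    split_ifs <;> omega
  · dsimp only
    split_ifs <;> omega
  · rcases hab with h | ⟨x, h⟩
    · refine ⟨f - z + 1, by omega, ?_⟩
      beta_reduce
      split_ifs <;> omega
    · refine ⟨f - z + 3 + (x - y), by omega, ?_⟩
      beta_reduce
      split_ifs <;> omega

/-- The path through `2 * f + 3, …, 2 * z + 3, 1, 2, …, 2 * x + 2, 0, 2 * y + 2, …, 2 * f + 2`. -/
lemma long_path {f x y z a b : ℕ} (hxy : x < y) (hy : y ≤ f) (hz : z ≤ f)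
    (hab : a = 0 ∧ b = 2 * x + 2 ∨ a = 0 ∧ b = 2 * y + 2 ∨ a = 1 ∧ b = 2) :
    HasPath f a b ((f - z) + x + 4 + (f - y)) := by
  refine ⟨fun j => if j ≤ f - z then 2 * (f - j) + 3 else if j = f - z + 1 then 1 else
      if j ≤ f - z + 2 + x then 2 * (j - (f - z + 2)) + 2 else
      if j = f - z + x + 3 then 0 else 2 * (y + (j - (f - z + x + 4))) + 2,
    ⟨?_, ?_⟩, ?_, ?_, ?_, ?_⟩
  · intro j hj
    split_ifs <;> omega
  · intro j hj
    unfold BlockAdj Arc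
    split_ifs <;> omega
  · intro i j h2 h3
    beta_reduce
    split_ifs <;> omega
  · dsimp only
    split_ifs <;> omega
  · dsimp only
    split_ifs <;> omega
  · rcases hab with h | h | h
    · refine ⟨f - z + x + 2, by omega, ?_⟩
      beta_reduce
      split_ifs <;> omega
    · refine ⟨f - z + x + 3, by omega, ?_⟩
      beta_reduce
      split_ifs <;> omega
    · refine ⟨f - z + 1, by omega, ?_⟩
      beta_reduce
      split_ifs <;> omega

lemma hasPath_hubs {f L : ℕ} (h3 : 3 ≤ L) (hL : L ≤ 2 * f + 3) : HasPath f 0 1 L := by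
  obtain ⟨y, z, hy, hz, rfl⟩ : ∃ y z, y ≤ f ∧ z ≤ f ∧ L = (f - z) + 3 + (f - y) := by
    by_cases h : L ≤ f + 3
    · exact ⟨f, f + 3 - L, by omega⟩
    · exact ⟨2 * f + 3 - L, 0, by omega⟩
  exact short_path hy hz (by omega)

/-- The two ranges of lengths of cycles and of terminal paths through `ab` overlap sufficiently. -/
def GoodEdge (f a b : ℕ) : Prop :=
  ∃ X Y, Y + f ≤ X ∧ Y ≤ 2 * f + 3 ∧ (∀ L, 3 ≤ L → L ≤ X → HasCycle f a b L) ∧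
    ∀ L, Y ≤ L → L ≤ 2 * f + 3 → HasPath f a b L

lemma GoodEdge.mirror {f a b : ℕ} (h : GoodEdge f a b) :
    GoodEdge f (mirror a) (mirror b) := by
  obtain ⟨X, Y, hXY, hY, hc, hp⟩ := h
  exact ⟨X, Y, hXY, hY, fun L h1 h2 => (hc L h1 h2).mirror, fun L h1 h2 => (hp L h1 h2).mirror⟩

lemma goodEdge_hubs (f : ℕ) : GoodEdge f 0 1 := by
  refine ⟨f + 3, 3, by omega, by omega, fun L h1 h2 => ?_, fun L h1 h2 => hasPath_hubs h1 h2⟩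
  obtain ⟨x, rfl⟩ := Nat.exists_eq_add_of_le' h1
  exact hub_cycle (by omega) (by omega)

lemma goodEdge_cross {f : ℕ} (hf : 1 ≤ f) : GoodEdge f 1 2 := by
  refine ⟨2 * f + 4, f + 3, by omega, by omega, fun L h1 h2 => ?_, fun L h1 h2 => ?_⟩
  · by_cases h : L ≤ f + 3
    · obtain ⟨x, rfl⟩ := Nat.exists_eq_add_of_le' h1
      exact hub_cycle (by omega) (by omega)
    · obtain ⟨x, rfl⟩ : ∃ x, L = x + f + 4 := ⟨L - (f + 4), by omega⟩
      exact double_cycle (by omega) (by omega) (by omega)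
  · obtain ⟨z, hz, rfl⟩ : ∃ z ≤ f, L = (f - z) + 0 + 4 + (f - 1) := ⟨2 * f + 3 - L, by omega⟩
    exact long_path (x := 0) (y := 1) (by omega) hf hz (by omega)

lemma hasCycle_spoke {f x L : ℕ} (hx : x ≤ f) (h3 : 3 ≤ L) (hL : L ≤ x + f + 4) :
    HasCycle f 0 (2 * x + 2) L := by
  by_cases h : L ≤ x + 2
  · obtain ⟨y, hy, rfl⟩ : ∃ y < x, L = x - y + 2 := ⟨x + 2 - L, by omega⟩
    exact fan_cycle hy hx (by omega)
  by_cases h' : L = x + 3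
  · subst h'
    exact hub_cycle hx (by omega)
  obtain ⟨y, rfl⟩ : ∃ y, L = x + y + 4 := ⟨L - (x + 4), by omega⟩
  exact double_cycle hx (by omega) (by omega)

lemma goodEdge_spoke {f x : ℕ} (hf : 1 ≤ f) (hx : x ≤ f) : GoodEdge f 0 (2 * x + 2) := by
  by_cases h : x = f
  · subst h
    refine ⟨2 * x + 4, x + 3, by omega, by omega,
      fun L h1 h2 => hasCycle_spoke le_rfl h1 (by omega), fun L h1 h2 => ?_⟩
    obtain ⟨z, hz, rfl⟩ : ∃ z ≤ x, L = (x - z) + (x - 1) + 4 + (x - x) :=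
      ⟨2 * x + 3 - L, by omega⟩
    exact long_path (by omega) le_rfl hz (by omega)
  · refine ⟨x + f + 4, x + 4, by omega, by omega,
      fun L h1 h2 => hasCycle_spoke hx h1 h2, fun L h1 h2 => ?_⟩
    obtain ⟨y, z, hy, hy', hz, rfl⟩ :
        ∃ y z, x < y ∧ y ≤ f ∧ z ≤ f ∧ L = (f - z) + x + 4 + (f - y) := by
      by_cases h : L ≤ f + x + 4
      · exact ⟨f, f + x + 4 - L, by omega⟩
      · exact ⟨2 * f + x + 4 - L, 0, by omega⟩
    exact long_path hy hy' hz (by omega)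

lemma goodEdge_path {f x : ℕ} (hx : x < f) : GoodEdge f (2 * x + 2) (2 * x + 4) := by
  refine ⟨2 * f + 4, f + 3, by omega, by omega, fun L h1 h2 => ?_, fun L h1 h2 => ?_⟩
  · by_cases h : L ≤ f + 2
    · obtain ⟨y, z, hyx, hxz, hz, rfl⟩ : ∃ y z, y ≤ x ∧ x < z ∧ z ≤ f ∧ L = z - y + 2 := by
        by_cases h : L ≤ x + 3
        · exact ⟨x + 3 - L, x + 1, by omega⟩
        · exact ⟨0, L - 2, by omega⟩
      exact fan_cycle (by omega) hz (.inr (.inr ⟨x, hyx, hxz, rfl, rfl⟩))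
    by_cases h' : L = f + 3
    · subst h'
      exact hub_cycle le_rfl (.inr (.inr (.inr ⟨x, hx, rfl, rfl⟩)))
    obtain ⟨y, rfl⟩ : ∃ y, L = f + y + 4 := ⟨L - (f + 4), by omega⟩
    exact double_cycle le_rfl (by omega) (.inr (.inr ⟨x, hx, rfl, rfl⟩))
  · obtain ⟨z, hz, rfl⟩ : ∃ z ≤ f, L = (f - z) + 3 + (f - 0) := ⟨2 * f + 3 - L, by omega⟩
    exact short_path (by omega) hz (.inr ⟨x, by omega, hx, rfl, rfl⟩)

lemma Arc.goodEdge_of_even {f a b : ℕ} (hf : 1 ≤ f) (h : Arc a b) (hb : b ≤ 2 * f + 3)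
    (he : b % 2 = 0) : GoodEdge f a b := by
  unfold Arc at h
  obtain ⟨x, rfl⟩ : ∃ x, b = 2 * x + 2 := ⟨b / 2 - 1, by omega⟩
  by_cases h0 : a = 0
  · subst h0
    exact goodEdge_spoke hf (by omega)
  by_cases h1 : a = 1
  · subst h1
    obtain rfl : x = 0 := by omega
    exact goodEdge_cross hf
  · obtain ⟨y, rfl⟩ : ∃ y, x = y + 1 := ⟨x - 1, by omega⟩
    obtain rfl : a = 2 * y + 2 := by omega
    exact goodEdge_path (by omega)

lemma Arc.goodEdge {f a b : ℕ} (hf : 1 ≤ f) (h : Arc a b) (hb : b ≤ 2 * f + 3) :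
    GoodEdge f a b := by
  by_cases he : b % 2 = 0
  · exact h.goodEdge_of_even hf hb he
  by_cases h01 : a = 0 ∧ b = 1
  · obtain ⟨rfl, rfl⟩ := h01
    exact goodEdge_hubs f
  · have hm : Arc (BlockRing.mirror a) (BlockRing.mirror b) := by
      unfold Arc BlockRing.mirror at *
      split_ifs <;> omega
    have hb' : BlockRing.mirror b = b - 1 := by
      unfold BlockRing.mirror
      rw [if_neg he]
    have := (hm.goodEdge_of_even (f := f) hf (by omega) (by omega)).mirror
    rwa [mirror_mirror, mirror_mirror] at this

lemma exists_walk_of_forall_adj {V : Type*} {G : SimpleGraph V} (c : ℕ → V) (L : ℕ)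
    (h : ∀ j < L, G.Adj (c j) (c (j + 1))) :
    ∃ p : G.Walk (c 0) (c L), p.length = L ∧ p.support = (List.range (L + 1)).map c ∧
      ∀ j < L, s(c j, c (j + 1)) ∈ p.edges := by
  induction L with
  | zero => exact ⟨.nil, rfl, rfl, by simp⟩
  | succ L ih =>
    obtain ⟨p, hl, hs, he⟩ := ih fun j hj => h j (by omega)
    refine ⟨p.concat (h L (by omega)), by simp [hl], ?_, fun j hj => ?_⟩
    · rw [Walk.support_concat, hs, List.range_succ (n := L + 1), List.map_append]
      simp
    · rw [Walk.edges_concat]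
      rcases Nat.lt_succ_iff_lt_or_eq.1 hj with h' | rfl
      · simp [he j h']
      · simp

lemma isCycle_of_nodup_support_tail {V : Type*} {G : SimpleGraph V} {u : V} {p : G.Walk u u}
    (h : p.support.tail.Nodup) (h3 : 3 ≤ p.length) : p.IsCycle := by
  rw [Walk.isCycle_iff_isPath_tail_and_le_length]
  refine ⟨?_, h3⟩
  rw [Walk.isPath_def, Walk.support_tail_of_not_nil]
  · exact h
  · rw [← Walk.length_eq_zero_iff]
    omega

lemma natCast_zmod_inj {k a b : ℕ} (ha : a < k) (hb : b < k) (h : (a : ZMod k) = b) : a = b := by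
  rwa [ZMod.natCast_eq_natCast_iff', Nat.mod_eq_of_lt ha, Nat.mod_eq_of_lt hb] at h

/-- The position of the vertex `x` of the `i`-th block in the ring of blocks. The terminal
`2 * f + 3` of a block is identified with the terminal `2 * f + 2` of the preceding one. -/
def place (f k : ℕ) (i : ZMod k) (x : ℕ) : ZMod k × Fin (2 * f + 3) :=
  if x = 2 * f + 3 then (i - 1, ⟨2 * f + 2, by omega⟩) else (i, ⟨min x (2 * f + 2), by omega⟩)

lemma place_terminal (f k : ℕ) (i : ZMod k) :
    place f k i (2 * f + 3) = place f k (i - 1) (2 * f + 2) := by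
  simp [place]

lemma place_fst {f k x : ℕ} (i : ZMod k) (hx : x ≠ 2 * f + 3) : (place f k i x).1 = i := by
  simp [place, hx]

lemma place_eq_place {f k x y : ℕ} {i j : ZMod k} (hx : x ≤ 2 * f + 3) (hy : y ≤ 2 * f + 3)
    (h : place f k i x = place f k j y) :
    i = j ∧ x = y ∨ x = 2 * f + 3 ∧ y = 2 * f + 2 ∧ j = i - 1 ∨
      x = 2 * f + 2 ∧ y = 2 * f + 3 ∧ i = j - 1 := by
  unfold place at h
  split_ifs at h with h1 h2 h2 <;> simp only [Prod.mk.injEq, Fin.mk.injEq] at h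
  · exact .inl ⟨by simpa using h.1, by omega⟩
  · exact .inr (.inl ⟨h1, by omega, h.1.symm⟩)
  · exact .inr (.inr ⟨by omega, h2, h.1⟩)
  · exact .inl ⟨h.1, by omega⟩

lemma place_injOn {f k x y : ℕ} (hk : 3 ≤ k) {i : ZMod k} (hx : x ≤ 2 * f + 3)
    (hy : y ≤ 2 * f + 3) (h : place f k i x = place f k i y) : x = y := by
  have : Fact (1 < k) := ⟨by omega⟩
  rcases place_eq_place hx hy h with h | h | h
  · exact h.2
  · exact absurd (sub_eq_self.1 h.2.2.symm) one_ne_zero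
  · exact absurd (sub_eq_self.1 h.2.2.symm) one_ne_zero

/-- The graph formed by `k` blocks arranged in a ring, consecutive ones sharing a terminal. -/
def ring (f k : ℕ) : SimpleGraph (ZMod k × Fin (2 * f + 3)) where
  Adj u v := u ≠ v ∧ ∃ i a b, BlockAdj a b ∧ a ≤ 2 * f + 3 ∧ b ≤ 2 * f + 3 ∧
    u = place f k i a ∧ v = place f k i b
  symm := ⟨fun _ _ ⟨hne, i, a, b, h, ha, hb, hu, hv⟩ => ⟨hne.symm, i, b, a, h.symm, hb, ha, hv, hu⟩⟩
  loopless := ⟨fun _ h => h.1 rfl⟩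

lemma BlockAdj.ne {a b : ℕ} (h : BlockAdj a b) : a ≠ b := by
  unfold BlockAdj Arc at h
  omega

lemma BlockAdj.ring_adj {f k a b : ℕ} (hk : 3 ≤ k) (i : ZMod k) (h : BlockAdj a b)
    (ha : a ≤ 2 * f + 3) (hb : b ≤ 2 * f + 3) :
    (ring f k).Adj (place f k i a) (place f k i b) :=
  ⟨fun h' => h.ne (place_injOn hk ha hb h'), i, a, b, h, ha, hb, rfl, rfl⟩

lemma IsBlockWalk.exists_walk {f k L : ℕ} (hk : 3 ≤ k) (i : ZMod k) {c : ℕ → ℕ}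
    (h : IsBlockWalk f c L) :
    ∃ p : (ring f k).Walk (place f k i (c 0)) (place f k i (c L)), p.length = L ∧
      p.support.tail = (List.range L).map (fun j => place f k i (c (j + 1))) ∧
      ∀ a b, Traverses c L a b → s(place f k i a, place f k i b) ∈ p.edges := by
  obtain ⟨p, hl, hs, he⟩ := exists_walk_of_forall_adj (G := ring f k)
    (fun j => place f k i (c j)) L
    fun j hj => (h.adj j hj).ring_adj hk i (h.le j (by omega)) (h.le (j + 1) (by omega))
  refine ⟨p, hl, ?_, ?_⟩
  · rw [hs, List.range_succ_eq_map]
    simp [Function.comp_def]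
  · rintro a b ⟨j, hj, ⟨rfl, rfl⟩ | ⟨rfl, rfl⟩⟩
    · exact he j hj
    · rw [Sym2.eq_swap]
      exact he j hj

lemma IsBlockWalk.nodup {f k L : ℕ} (hk : 3 ≤ k) (i : ZMod k) {c : ℕ → ℕ}
    (h : IsBlockWalk f c L) (hc : ∀ i j, 1 ≤ i → i < j → j ≤ L → c i ≠ c j) :
    ((List.range L).map (fun j => place f k i (c (j + 1)))).Nodup := by
  refine List.Nodup.map_on (fun x hx y hy hxy => ?_) List.nodup_range
  rw [List.mem_range] at hx hy
  have := place_injOn hk (h.le _ (by omega)) (h.le _ (by omega)) hxy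
  rcases lt_trichotomy x y with h' | h' | h'
  · exact absurd this (hc _ _ (by omega) (by omega) (by omega))
  · exact h'
  · exact absurd this.symm (hc _ _ (by omega) (by omega) (by omega))

lemma HasCycle.edgeInCycleOfLength {f k a b L : ℕ} (hk : 3 ≤ k) (i : ZMod k) (h3 : 3 ≤ L)
    (h : HasCycle f a b L) :
    (ring f k).EdgeInCycleOfLength s(place f k i a, place f k i b) L := by
  obtain ⟨c, hw, hinj, h0, ht⟩ := h
  obtain ⟨p, hl, hs, he⟩ := hw.exists_walk hk i
  refine ⟨_, p.copy (congrArg _ h0) rfl, isCycle_of_nodup_support_tail ?_ ?_, ?_, ?_⟩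
  · rw [Walk.support_copy, hs]
    exact hw.nodup hk i hinj
  · rwa [Walk.length_copy, hl]
  · rwa [Walk.length_copy]
  · rw [Walk.edges_copy]
    exact he a b ht

lemma HasPath.exists_walk {f k a b L : ℕ} (hk : 3 ≤ k) (i : ZMod k) (h : HasPath f a b L) :
    ∃ p : (ring f k).Walk (place f k (i - 1) (2 * f + 2)) (place f k i (2 * f + 2)),
      p.length = L ∧ p.support.tail.Nodup ∧ (∀ v ∈ p.support.tail, v.1 = i) ∧
      s(place f k i a, place f k i b) ∈ p.edges := by
  obtain ⟨c, hw, hinj, h0, hL, ht⟩ := h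
  obtain ⟨p, hl, hs, he⟩ := hw.exists_walk hk i
  refine ⟨p.copy (by rw [h0, place_terminal]) (by rw [hL]), by simpa using hl, ?_, ?_, ?_⟩
  · rw [Walk.support_copy, hs]
    exact hw.nodup hk i fun i j _ => hinj i j
  · rw [Walk.support_copy, hs]
    intro v hv
    obtain ⟨j, hj, rfl⟩ := List.mem_map.1 hv
    rw [List.mem_range] at hj
    exact place_fst i fun h => hinj 0 (j + 1) (by omega) (by omega) (h0.trans h.symm)
  · rw [Walk.edges_copy]
    exact he a b ht

lemma exists_ring_walk {f k : ℕ} (hk : 3 ≤ k) (i : ZMod k) {r : ℕ} (hr : r ≤ k) {L : ℕ}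
    (h1 : 3 * r ≤ L) (h2 : L ≤ r * (2 * f + 3)) :
    ∃ p : (ring f k).Walk (place f k i (2 * f + 2)) (place f k (i + r) (2 * f + 2)),
      p.length = L ∧ p.support.tail.Nodup ∧
      ∀ v ∈ p.support.tail, ∃ q < r, v.1 = i + (q : ZMod k) + 1 := by
  induction r generalizing L with
  | zero =>
    obtain rfl : L = 0 := by omega
    exact ⟨Walk.nil.copy rfl (by simp), by simp⟩
  | succ r ih =>
    have hm : 3 * r ≤ r * (2 * f + 3) := by rw [mul_comm]; gcongr; omega
    rw [add_one_mul] at h2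
    obtain ⟨M, N, rfl, hM, hM', hN, hN'⟩ : ∃ M N, L = M + N ∧ 3 * r ≤ M ∧ M ≤ r * (2 * f + 3) ∧
        3 ≤ N ∧ N ≤ 2 * f + 3 := by
      by_cases h : L ≤ 3 * r + (2 * f + 3)
      · exact ⟨3 * r, L - 3 * r, by omega⟩
      · exact ⟨L - (2 * f + 3), 2 * f + 3, by omega⟩
    obtain ⟨p, hp, hpn, hpv⟩ := ih (by omega) hM hM'
    obtain ⟨q, hq, hqn, hqv, -⟩ := (hasPath_hubs hN hN').exists_walk hk (i + r + 1)
    refine ⟨p.append (q.copy (by rw [add_sub_cancel_right]) (by push_cast; rw [add_assoc])),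
      by simp [hp, hq], ?_, ?_⟩
    · rw [Walk.tail_support_append, Walk.support_copy]
      refine hpn.append hqn fun v hv hv' => ?_
      obtain ⟨s, hs, hsv⟩ := hpv v hv
      rw [hqv v hv'] at hsv
      have := natCast_zmod_inj (k := k) (by omega) (by omega)
        (add_left_cancel (add_right_cancel hsv))
      omega
    · rw [Walk.tail_support_append, Walk.support_copy]
      intro v hv
      rcases List.mem_append.1 hv with hv | hv
      · obtain ⟨s, hs, hsv⟩ := hpv v hv
        exact ⟨s, by omega, hsv⟩
      · exact ⟨r, by omega, hqv v hv⟩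

lemma GoodEdge.edgeInCycleOfLength {f k a b N : ℕ} (hk : 3 ≤ k) (hf : f + 1 = 3 * (k - 1))
    (i : ZMod k) (h : GoodEdge f a b) (h3 : 3 ≤ N) (hN : N ≤ k * (2 * f + 3)) :
    (ring f k).EdgeInCycleOfLength s(place f k i a, place f k i b) N := by
  obtain ⟨X, Y, hXY, hY, hc, hp⟩ := h
  by_cases hX : N ≤ X
  · exact (hc N h3 hX).edgeInCycleOfLength hk i h3
  obtain ⟨r, rfl⟩ : ∃ r, k = r + 1 := ⟨k - 1, by omega⟩
  rw [Nat.add_sub_cancel] at hf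
  rw [add_one_mul] at hN
  have hm : 3 * r ≤ r * (2 * f + 3) := by rw [mul_comm]; gcongr; omega
  obtain ⟨L, M, rfl, hL, hL', hM, hM'⟩ : ∃ L M, N = L + M ∧ Y ≤ L ∧ L ≤ 2 * f + 3 ∧
      3 * r ≤ M ∧ M ≤ r * (2 * f + 3) := by
    by_cases h : N ≤ 3 * r + (2 * f + 3)
    · exact ⟨N - 3 * r, 3 * r, by omega⟩
    · exact ⟨2 * f + 3, N - (2 * f + 3), by omega⟩
  obtain ⟨p, hpl, hpn, hpv, hpe⟩ := (hp L hL hL').exists_walk hk i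
  obtain ⟨q, hql, hqn, hqv⟩ := exists_ring_walk hk i (r := r) (by omega) hM hM'
  have hr : ((r : ℕ) : ZMod (r + 1)) + 1 = 0 := by exact_mod_cast ZMod.natCast_self (r + 1)
  have hir : i + (r : ZMod (r + 1)) = i - 1 := by
    rw [sub_eq_add_neg, eq_neg_of_add_eq_zero_left hr]
  refine ⟨_, p.append (q.copy rfl (by rw [hir])), isCycle_of_nodup_support_tail ?_ ?_, ?_, ?_⟩
  · rw [Walk.tail_support_append, Walk.support_copy]
    refine hpn.append hqn fun v hv hv' => ?_
    obtain ⟨s, hs, hsv⟩ := hqv v hv'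
    rw [hpv v hv, add_assoc, left_eq_add] at hsv
    have := natCast_zmod_inj (k := r + 1) (a := s + 1) (b := 0) (by omega) (by omega)
      (by exact_mod_cast hsv)
    omega
  · simp [hpl, hql, h3]
  · simp [hpl, hql]
  · simp [hpe]

/-- The edges of a block, each listed once. -/
def arcs (f : ℕ) : Set (ℕ × ℕ) := {e | Arc e.1 e.2 ∧ e.2 ≤ 2 * f + 3}

lemma edgeSet_ring {f k : ℕ} (hk : 3 ≤ k) :
    (ring f k).edgeSet =
      (fun e : ZMod k × ℕ × ℕ => s(place f k e.1 e.2.1, place f k e.1 e.2.2)) ''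
        (Set.univ ×ˢ arcs f) := by
  ext e
  induction e with | _ u v
  rw [mem_edgeSet]
  constructor
  · rintro ⟨-, i, a, b, h | h, ha, hb, rfl, rfl⟩
    · exact ⟨(i, a, b), ⟨trivial, h, hb⟩, rfl⟩
    · exact ⟨(i, b, a), ⟨trivial, h, ha⟩, Sym2.eq_swap⟩
  · rintro ⟨⟨i, a, b⟩, ⟨-, h, hb⟩, he⟩
    have := BlockAdj.ring_adj (f := f) hk i (.inl h) (h.1.le.trans hb) hb
    rwa [← mem_edgeSet, ← he]

lemma ring_edge_injOn {f k : ℕ} (hk : 3 ≤ k) :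
    Set.InjOn (fun e : ZMod k × ℕ × ℕ => s(place f k e.1 e.2.1, place f k e.1 e.2.2))
      (Set.univ ×ˢ arcs f) := by
  have : Fact (1 < k) := ⟨by omega⟩
  rintro ⟨i, a, b⟩ ⟨-, h, hb⟩ ⟨j, c, d⟩ ⟨-, h', hd⟩ he
  replace he : s(place f k i a, place f k i b) = s(place f k j c, place f k j d) := he
  replace hb : b ≤ 2 * f + 3 := hb
  replace hd : d ≤ 2 * f + 3 := hd
  have hab : a < b := h.1
  have hcd : c < d := h'.1
  rcases Sym2.eq_iff.1 he with ⟨h1, h2⟩ | ⟨h1, h2⟩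
  · rcases place_eq_place (by omega) (by omega) h1 with ⟨rfl, rfl⟩ | h | h
    · rw [place_injOn hk hb hd h2]
    · omega
    · omega
  · rcases place_eq_place (by omega) (by omega) h1 with ⟨rfl, rfl⟩ | h | ⟨-, -, h⟩
    · have := place_injOn hk hb (by omega) h2
      omega
    · omega
    · rcases place_eq_place (by omega) (by omega) h2 with ⟨rfl, rfl⟩ | ⟨-, -, h'⟩ | h'
      · exact absurd (sub_eq_self.1 h.symm) one_ne_zero
      · have h2 : ((2 : ℕ) : ZMod k) = (0 : ℕ) := by
          push_cast
          linear_combination h + h'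
        exact absurd (natCast_zmod_inj (by omega) (by omega) h2) two_ne_zero
      · omega

lemma ncard_arcs (f : ℕ) : (arcs f).ncard = 4 * f + 5 := by
  induction f with
  | zero =>
    have : arcs 0 = (({(0, 1), (0, 2), (0, 3), (1, 2), (1, 3)} : Finset (ℕ × ℕ)) : Set _) := by
      ext ⟨a, b⟩
      simp [arcs, Arc]
      omega
    rw [this, Set.ncard_coe_finset]
    rfl
  | succ f ih =>
    have : arcs (f + 1) = arcs f ∪ (({(0, 2 * f + 4), (1, 2 * f + 5), (2 * f + 2, 2 * f + 4),
        (2 * f + 3, 2 * f + 5)} : Finset (ℕ × ℕ)) : Set _) := by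
      ext ⟨a, b⟩
      simp [arcs, Arc]
      omega
    have hfin : (arcs f).Finite := Set.finite_of_ncard_pos (by omega)
    rw [this, Set.ncard_union_eq _ hfin (Finset.finite_toSet _), ih, Set.ncard_coe_finset]
    · rw [Finset.card_insert_of_notMem (by simp), Finset.card_insert_of_notMem (by simp),
        Finset.card_insert_of_notMem (by simp), Finset.card_singleton]
      ring
    · rw [Set.disjoint_left]
      rintro ⟨a, b⟩ ⟨-, h⟩ h'
      simp at h h'
      omega

lemma ncard_edgeSet_ring {f k : ℕ} (hk : 3 ≤ k) :
    (ring f k).edgeSet.ncard = k * (4 * f + 5) := by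
  rw [edgeSet_ring hk, (ring_edge_injOn hk).ncard_image, Set.ncard_prod, ncard_arcs,
    Set.ncard_univ, Nat.card_zmod]

lemma edgeInCycleOfLength_ring {f k N : ℕ} (hk : 3 ≤ k) (hf : f + 1 = 3 * (k - 1))
    (h3 : 3 ≤ N) (hN : N ≤ k * (2 * f + 3)) {e : Sym2 (ZMod k × Fin (2 * f + 3))}
    (he : e ∈ (ring f k).edgeSet) : (ring f k).EdgeInCycleOfLength e N := by
  rw [edgeSet_ring hk] at he
  obtain ⟨⟨i, a, b⟩, ⟨-, h, hb⟩, rfl⟩ := he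
  exact (h.goodEdge (by omega) hb).edgeInCycleOfLength hk hf i h3 hN

end BlockRing

lemma SimpleGraph.EdgeInCycleOfLength.map_iso {V W : Type*} {G : SimpleGraph V}
    {H : SimpleGraph W} (φ : G ≃g H) {e : Sym2 V} {n : ℕ} (h : G.EdgeInCycleOfLength e n) :
    H.EdgeInCycleOfLength (e.map φ) n := by
  obtain ⟨v, c, hc, hl, he⟩ := h
  refine ⟨φ v, c.map φ.toHom, hc.map φ.injective, by simpa using hl, ?_⟩
  rw [Walk.edges_map]
  exact List.mem_map_of_mem he

/-- for every `k ≥ 3` and `n = 6k² - 5k`, there exists an edge-pancyclic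
graph of order `n` with exactly `2n - k` edges. -/
theorem statement_13 (k : ℕ) (hk : 3 ≤ k) :
    ∃ G : SimpleGraph (Fin (6 * k ^ 2 - 5 * k)), G.EdgePancyclic ∧
      G.edgeSet.ncard = 2 * (6 * k ^ 2 - 5 * k) - k := by
  obtain ⟨f, hf⟩ : ∃ f, f + 1 = 3 * (k - 1) :=
    ⟨3 * (k - 1) - 1, by omega⟩
  have : NeZero k := ⟨by omega⟩
  have hn : k * (2 * f + 3) = 6 * k ^ 2 - 5 * k := by
    rw [show 2 * f + 3 = 6 * k - 5 by omega, Nat.mul_sub]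
    ring_nf
  have hcard : Fintype.card (ZMod k × Fin (2 * f + 3)) = 6 * k ^ 2 - 5 * k := by
    rw [Fintype.card_prod, ZMod.card, Fintype.card_fin, hn]
  let φ := (BlockRing.ring f k).overFinIso hcard
  refine ⟨(BlockRing.ring f k).overFin hcard, fun N h3 hN e he => ?_, ?_⟩
  · rw [Fintype.card_fin, ← hn] at hN
    have := (BlockRing.edgeInCycleOfLength_ring hk hf h3 hN
      (φ.symm.mapEdgeSet ⟨e, he⟩).2).map_iso φ
    have h' : ((φ.symm.mapEdgeSet ⟨e, he⟩ : Sym2 _)).map φ = e := by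
      simp [Sym2.map_map]
    rwa [h'] at this
  · rw [← Nat.card_coe_set_eq, ← Nat.card_congr φ.mapEdgeSet, Nat.card_coe_set_eq,
      BlockRing.ncard_edgeSet_ring hk, ← hn, show 4 * f + 5 = 2 * (2 * f + 3) - 1 by omega,
      Nat.mul_sub]
    ring_nf
end

section
/- Let s ≥ e^8 be an integer and let ℓ = ⌈s/ln s⌉. For n = (100s − 1)·s^ℓ, there exists an edge-pancyclic graph G of order n with e(G) ≤ 2n − n/(200 ln n). -/
namespace BlockChain

/-- The list of consecutive integers from `i` to `j`, in increasing or decreasing order. -/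
def seg (i j : ℕ) : List ℕ :=
  if i ≤ j then List.range' i (j + 1 - i) else (List.range' j (i + 1 - j)).reverse

/-- Adjacency, for `u < v`, in the double fan with terminals `s` and `s + 17`, apart from the edges
joining consecutive integers: `s + 8` is joined to the first half, `s + 9` to the second half. -/
def fanAdj (s u v : ℕ) : Bool :=
  bif u.ble (s + 7) then (v.beq (s + 8) && !u.beq (s + 7)) || (v.beq (s + 9) && u.beq (s + 7))
  else bif u.beq (s + 8) then v.beq (s + 10)
  else u.beq (s + 9) && (s + 11).ble v && v.ble (s + 17)

/-- Adjacency, for `u < v ≤ a + 45`, in the block with hub `0` and rim `1, …, a + 45`, without the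
spoke to the last rim vertex. -/
def blockAdj (a u v : ℕ) : Bool :=
  bif u.beq 0 then v.ble (a + 3) || v.beq (a + 44)
  else v.beq (u + 1) ||
    bif (a + 27).ble u then fanAdj (a + 27) u v
    else bif (a + 10).ble u then fanAdj (a + 10) u v
    else u.beq (a + 2) && v.ble (a + 10)

/-- Symmetric adjacency in the block, including the spoke to the last rim vertex. -/
def adj (a u v : ℕ) : Bool :=
  bif u.blt v then v.ble (a + 45) && (blockAdj a u v || (u.beq 0 && v.beq (a + 45)))
  else v.blt u && u.ble (a + 45) && (blockAdj a v u || (v.beq 0 && u.beq (a + 45)))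

/-- Add `v` in front of `l`, bypassing leading vertices of `l` not in `keep` where possible. -/
def push (r : ℕ → ℕ → Bool) (keep : ℕ → Bool) (v : ℕ) : List ℕ → List ℕ
  | x :: y :: t => bif !keep x && r v y then push r keep v (y :: t) else v :: x :: y :: t
  | l => v :: l

/-- Shortcut a path from right to left, never bypassing the vertices in `keep`. -/
def prune (r : ℕ → ℕ → Bool) (keep : ℕ → Bool) (l : List ℕ) : List ℕ :=
  l.foldr (push r keep) []

/-- Whether consecutive members of `l` are related by `r`. -/
def isChain (r : ℕ → ℕ → Bool) : List ℕ → Bool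
  | [] => true
  | [_] => true
  | x :: y :: t => r x y && isChain r (y :: t)

/-- Whether the members of `l` are distinct and avoid the bits of `m`. -/
def distinct (m : ℕ) : List ℕ → Bool
  | [] => true
  | x :: t => bif m.testBit x then false else distinct (m ||| 2 ^ x) t

/-- The fan centres, which are bypassed only in a second round of shortcuts. -/
def centre (a v : ℕ) : Bool :=
  v.beq (a + 2) || v.beq (a + 18) || v.beq (a + 19) || v.beq (a + 35) || v.beq (a + 36)

/-- The number of vertices of the path obtained from `l` by shortcutting. -/
def minLen (a : ℕ) (l : List ℕ) : ℕ :=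
  (prune (adj a) (fun _ => false) (prune (adj a) (centre a) l)).length

/-- Paths certifying that an edge `{u, v}` of a block is well behaved: a path from one end to the
last rim vertex and a disjoint one from the hub to the other end; paths joining the ends; and
disjoint paths from one end to the last rim vertex and from the first rim vertex to the other. -/
structure Cert where
  toLast : List ℕ
  fromHub : List ℕ
  direct : List (List ℕ)
  crossing : List (List ℕ × List ℕ)

def rimCert (a u : ℕ) (d : List (List ℕ)) : Cert :=
  ⟨seg (u + 1) (a + 45), 0 :: seg 1 u, (seg (u + 1) (a + 44) ++ 0 :: seg 1 u) :: d, []⟩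

def fanCert (a s u v : ℕ) : Cert :=
  bif v.beq (u + 1) then rimCert a u
    [seg v (s + 7) ++ (s + 8) :: seg s u,
      seg v (s + 7) ++ (s + 9) :: seg (s + 17) (s + 10) ++ (s + 8) :: seg s u,
      (s + 8) :: seg s u, (s + 8) :: seg s 1 ++ 0 :: seg (a + 44) (s + 17) ++ [s + 9, s + 7],
      (s + 9) :: seg (s + 7) s ++ [s + 8], (s + 9) :: seg (s + 17) (s + 10) ++ [s + 8],
      seg v (s + 17) ++ [s + 9], (s + 10) :: (s + 8) :: seg s (s + 7) ++ [s + 9],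
      (s + 10) :: seg (s + 8) 1 ++ 0 :: seg (a + 44) (s + 17) ++ [s + 9],
      seg v (s + 17) ++ (s + 9) :: seg (s + 10) u,
      seg v (s + 17) ++ (s + 9) :: seg (s + 7) s ++ (s + 8) :: seg (s + 10) u]
  else bif v.beq (s + 8) then
    ⟨v :: seg (u + 1) (s + 7) ++ seg (s + 9) (a + 45), 0 :: seg 1 u,
      [v :: seg (s + 7) u, v :: seg s u, v :: seg (s + 10) (s + 17) ++ (s + 9) :: seg (s + 7) u,
        v :: seg s 1 ++ 0 :: seg (a + 44) (s + 17) ++ (s + 9) :: seg (s + 7) u], []⟩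
  else bif u.beq (s + 8) then
    ⟨v :: seg (s + 9) (s + 9) ++ seg (s + 11) (a + 45), 0 :: seg 1 u,
      [u :: (s + 9) :: seg (s + 17) v, u :: seg s (s + 7) ++ (s + 9) :: seg (s + 17) v], []⟩
  else bif u.beq (s + 7) then
    ⟨seg v (a + 45), 0 :: seg 1 (s + 6) ++ [s + 8, u],
      [v :: (s + 8) :: seg s u, v :: seg (s + 17) (s + 10) ++ (s + 8) :: seg s u], []⟩
  else
    ⟨seg v (a + 45), 0 :: seg 1 (s + 8) ++ seg (s + 10) (v - 1) ++ [u],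
      [u :: seg (s + 10) v, u :: seg (s + 17) v,
        u :: seg (s + 7) s ++ (s + 8) :: seg (s + 10) v,
        u :: seg (s + 17) (a + 44) ++ 0 :: seg 1 (s + 8) ++ seg (s + 10) v], []⟩

def cert (a u v : ℕ) : Cert :=
  bif u.beq 0 then
    bif v.beq (a + 44) then
      ⟨[v, a + 45], [0], [],
        [([v, a + 45], seg 1 (a + 3) ++ [0]),
          ([v, a + 45], seg 1 (a + 2) ++ seg (a + 10) (a + 3) ++ [0]), ([0, a + 45], seg 1 v)]⟩
    else
      ⟨seg v (a + 45), [0],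
        [seg v (a + 3) ++ [0], seg v (a + 44) ++ [0], seg v 1 ++ [0],
          seg v (a + 2) ++ seg (a + 10) (a + 3) ++ [0], seg v (a + 10) ++ seg (a + 2) 1 ++ [0]],
        [(0 :: seg (v + 1) (a + 45), seg 1 v),
          (v :: (a + 2) :: seg (a + 4) (a + 45), seg 1 (a + 1) ++ [0]),
          (seg v (a + 45), seg 1 (a + 1) ++ [0])]⟩
  else bif v.beq (a + 45) then
    ⟨[v], [0, u], [],
      [([v], seg 1 (a + 3) ++ [0, u]), ([v], seg 1 (a + 2) ++ seg (a + 10) (a + 3) ++ [0, u]),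
        ([v], 1 :: 0 :: seg 2 u), ([v], seg 1 u)]⟩
  else bif (a + 27).ble u then fanCert a (a + 27) u v
  else bif (a + 10).ble u then fanCert a (a + 10) u v
  else bif v.beq (u + 1) then rimCert a u
    [seg v (a + 3) ++ 0 :: seg 1 u, seg v (a + 2) ++ seg (a + 10) (a + 3) ++ 0 :: seg 1 u,
      seg v (a + 10) ++ [a + 2], (a + 3) :: 0 :: seg (a + 44) (a + 10) ++ [a + 2],
      seg v (a + 10) ++ (a + 2) :: seg (a + 3) u,
      seg v (a + 10) ++ seg (a + 2) 1 ++ 0 :: seg (a + 3) u]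
  else
    ⟨seg v (a + 45), 0 :: seg 1 u,
      [seg v (a + 3) ++ [u], seg v (a + 10) ++ [u], seg v (a + 3) ++ 0 :: seg 1 u,
        seg v (a + 44) ++ 0 :: seg 1 u, seg v (a + 3) ++ 0 :: seg (a + 44) (a + 10) ++ [u]],
      [(seg v (a + 45), seg 1 (a + 1) ++ 0 :: seg (a + 3) (v - 1) ++ [u])]⟩

/-- Whether `l` has ends `u` and `v`. -/
def hasEnds (u v : ℕ) (l : List ℕ) : Bool := l.head? == some u && l.getLast? == some v

/-- Whether every integer in `[lo, hi]` lies in one of the given intervals. -/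
def covers (lo hi : ℕ) (is : List (ℕ × ℕ)) : Bool :=
  (List.range' lo (hi + 1 - lo)).all fun k => is.any fun i => i.1.ble k && k.ble i.2

def interval (a : ℕ) (l : List ℕ) : ℕ × ℕ := (minLen a l, l.length)

def intervalPair (a : ℕ) (l m : List ℕ) : ℕ × ℕ := (minLen a l + minLen a m, l.length + m.length)

/-- All vertices lie in the block. -/
def inBlock (a : ℕ) (l : List ℕ) : Bool := l.all fun v => v.ble (a + 45)

/-- Disjoint paths `x ⇝ y` and `x' ⇝ y'`. -/
def checkPair (a x y x' y' : ℕ) (l m : List ℕ) : Bool :=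
  hasEnds x y l && hasEnds x' y' m && isChain (adj a) l && isChain (adj a) m &&
    distinct 0 (l ++ m) && inBlock a (l ++ m)

def checkDirect (a u v : ℕ) (l : List ℕ) : Bool :=
  (hasEnds u v l || hasEnds v u l) && isChain (adj a) l && distinct 0 l && inBlock a l

def checkCert (a u v : ℕ) (c : Cert) : Bool :=
  (checkPair a u (a + 45) 0 v c.toLast c.fromHub || checkPair a v (a + 45) 0 u c.toLast c.fromHub)
  && covers 3 (c.toLast.length + c.fromHub.length - 1)
    (intervalPair a c.toLast c.fromHub ::
      (c.direct.filter (checkDirect a u v)).map (interval a))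
  && covers (c.toLast.length + c.fromHub.length + 1) (a + 46)
    ((c.crossing.filter fun p => checkPair a u (a + 45) 1 v p.1 p.2
      || checkPair a v (a + 45) 1 u p.1 p.2).map fun p => intervalPair a p.1 p.2)

def blockEdges (a : ℕ) : List (ℕ × ℕ) :=
  (List.range' 0 (a + 45)).flatMap fun u =>
    ((List.range' (u + 1) (a + 45 - u)).filter (blockAdj a u)).map (Prod.mk u)

def checkEdges (a : ℕ) : Bool := (blockEdges a).all fun e => checkCert a e.1 e.2 (cert a e.1 e.2)

def hubPaths (a : ℕ) : List (List ℕ) :=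
  [seg 1 (a + 3) ++ [0], seg 1 (a + 2) ++ seg (a + 10) (a + 3) ++ [0], seg 1 (a + 44) ++ [0]]

def checkHub (a : ℕ) : Bool :=
  ((hubPaths a).all fun l =>
      isChain (adj a) l && distinct 0 l && hasEnds 1 0 l && l.all fun v => v.ble (a + 44)) &&
    covers 2 (a + 45) ((hubPaths a).map (interval a))

def checkRim (a : ℕ) : Bool :=
  isChain (adj a) (seg 1 (a + 45)) && distinct 0 (seg 1 (a + 45)) &&
  hasEnds 1 (a + 45) (seg 1 (a + 45)) &&
  (seg 1 (a + 45)).length == a + 45 && (seg 1 (a + 45)).all fun v => (1).ble v && v.ble (a + 45)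

/-- `l` is the vertex list of a path from `a` to `b` for the relation `A`. -/
def PathList (A : ℕ → ℕ → Prop) (a b : ℕ) (l : List ℕ) : Prop :=
  l.IsChain A ∧ l.Nodup ∧ l.head? = some a ∧ l.getLast? = some b

namespace PathList

variable {A B : ℕ → ℕ → Prop} {a b c d : ℕ} {l m : List ℕ}

theorem left_mem (h : PathList A a b l) : a ∈ l := List.mem_of_mem_head? h.2.2.1

theorem right_mem (h : PathList A a b l) : b ∈ l := List.mem_of_mem_getLast? h.2.2.2

theorem append (hl : PathList A a b l) (hm : PathList A c d m) (hbc : A b c)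
    (hlm : ∀ v ∈ l, v ∉ m) : PathList A a d (l ++ m) := by
  obtain ⟨h₁, h₂, h₃, h₄⟩ := hl
  obtain ⟨h₅, h₆, h₇, h₈⟩ := hm
  refine ⟨List.isChain_append.2 ⟨h₁, h₅, ?_⟩, List.nodup_append.2 ⟨h₂, h₆, ?_⟩, ?_, ?_⟩
  · intro u hu v hv
    simp_all
  · rintro u hu v hv rfl
    exact hlm u hu hv
  · simp [h₃]
  · simp [h₈]

theorem glue (hl : PathList A a c l) (hm : PathList A c b m) (hlm : ∀ v ∈ l, v ∈ m → v = c) :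
    PathList A a b (l ++ m.tail) := by
  obtain ⟨h₅, h₆, h₇, h₈⟩ := hm
  obtain _ | ⟨x, t⟩ := m
  · simp at h₇
  obtain rfl : x = c := by simpa using h₇
  obtain _ | ⟨y, t⟩ := t
  · obtain rfl : x = b := by simpa using h₈
    simpa using hl
  · rw [List.isChain_cons_cons] at h₅
    refine hl.append (c := y) ⟨h₅.2, h₆.of_cons, rfl, by simpa using h₈⟩ h₅.1 fun v hv hv' => ?_
    obtain rfl := hlm v hv (List.mem_cons_of_mem _ hv')
    exact (List.nodup_cons.1 h₆).1 hv'

theorem length_glue (hm : PathList A c b m) : (l ++ m.tail).length + 1 = l.length + m.length := by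
  have := List.length_pos_of_mem hm.left_mem
  simp only [List.length_append, List.length_tail]
  omega

theorem reverse (hA : ∀ u v, A u v → A v u) (h : PathList A a b l) :
    PathList A b a l.reverse := by
  obtain ⟨h₁, h₂, h₃, h₄⟩ := h
  refine ⟨List.isChain_reverse.2 (h₁.imp fun u v => hA u v), by simpa, by simpa, by simpa⟩

theorem map {f : ℕ → ℕ} (hf : f.Injective) (hAB : ∀ u v, A u v → B (f u) (f v))
    (h : PathList A a b l) : PathList B (f a) (f b) (l.map f) := by
  obtain ⟨h₁, h₂, h₃, h₄⟩ := h
  refine ⟨List.isChain_map_of_isChain f hAB h₁, h₂.map hf, by simp [h₃], by simp [h₄]⟩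

end PathList

/-- There are disjoint paths `a ⇝ y` and `s ⇝ b` among the hub `0` and the rim vertices in `[x, y]`,
with `N` vertices in total. -/
def Linked (A : ℕ → ℕ → Prop) (x y s a b N : ℕ) : Prop :=
  ∃ l m, PathList A a y l ∧ PathList A s b m ∧ (∀ v ∈ l, v ∉ m) ∧
    (∀ v ∈ l, v = 0 ∨ x ≤ v ∧ v ≤ y) ∧ (∀ v ∈ m, v = 0 ∨ x ≤ v ∧ v ≤ y) ∧ l.length + m.length = N

/-- There is a path `a ⇝ b` among the hub `0` and the rim vertices in `[x, y]`, with `N` vertices. -/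
def Direct (A : ℕ → ℕ → Prop) (x y a b N : ℕ) : Prop :=
  ∃ l, PathList A a b l ∧ (∀ v ∈ l, v = 0 ∨ x ≤ v ∧ v ≤ y) ∧ l.length = N

/-- The invariant of the rim segment `[x, y]` that is preserved under concatenation. -/
structure Chainable (A : ℕ → ℕ → Prop) (D : Finset (ℕ × ℕ)) (x y : ℕ) : Prop where
  rim : ∃ l, PathList A x y l ∧ (∀ v ∈ l, x ≤ v ∧ v ≤ y) ∧ l.length = y + 1 - x
  hub : ∀ N, 2 ≤ N → N ≤ y + 1 - x →
    ∃ l, PathList A x 0 l ∧ (∀ v ∈ l, v = 0 ∨ x ≤ v ∧ v < y) ∧ l.length = N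
  edge : ∀ e ∈ D, ∃ R, (Linked A x y 0 e.1 e.2 R ∨ Linked A x y 0 e.2 e.1 R) ∧
    (∀ N, 3 ≤ N → N < R → Direct A x y e.1 e.2 N) ∧
    ∀ N, R < N → N ≤ y + 2 - x → Linked A x y x e.1 e.2 N ∨ Linked A x y x e.2 e.1 N

section Concatenation

variable {A B : ℕ → ℕ → Prop} {D D₁ D₂ : Finset (ℕ × ℕ)} {x y z s a b N M : ℕ}

theorem Linked.mono (h : Linked A z y s a b N) (hxz : x ≤ z) : Linked A x y s a b N := by
  obtain ⟨l, m, hl, hm, hlm, hl', hm', hN⟩ := h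
  exact ⟨l, m, hl, hm, hlm, fun v hv => by grind, fun v hv => by grind, hN⟩

theorem Direct.mono {x' y' : ℕ} (h : Direct A x y a b N) (hx : x' ≤ x) (hy : y ≤ y') :
    Direct A x' y' a b N := by
  obtain ⟨l, hl, hl', hN⟩ := h
  exact ⟨l, hl, fun v hv => by grind, hN⟩

theorem Direct.symm (hA : ∀ u v, A u v → A v u) (h : Direct A x y a b N) : Direct A x y b a N := by
  obtain ⟨l, hl, hl', hN⟩ := h
  exact ⟨l.reverse, hl.reverse hA, by simpa using hl', by simpa using hN⟩

theorem Linked.extend_right (hx : 1 ≤ x) (hxz : x ≤ z) (hzy : z ≤ y) (h₂ : Chainable A D z y)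
    (h : Linked A x z s a b N) : Linked A x y s a b (N + (y - z)) := by
  obtain ⟨l, m, hl, hm, hlm, hl', hm', hN⟩ := h
  obtain ⟨p, hp, hp', hpl⟩ := h₂.rim
  have hz := hl.right_mem
  have hlen := hp.length_glue (l := l)
  refine ⟨l ++ p.tail, m, hl.glue hp fun v hv hv' => ?_, hm, fun v hv hv' => ?_, fun v hv => ?_,
    fun v hv => ?_, by omega⟩
  · have := hl' v hv; have := hp' v hv'; omega
  · rcases List.mem_append.1 hv with hv | hv
    · exact hlm v hv hv'
    · have := hp' v (List.mem_of_mem_tail hv)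
      have := hm' v hv'
      obtain rfl : v = z := by omega
      exact hlm v hz hv'
  · rcases List.mem_append.1 hv with hv | hv
    · have := hl' v hv; omega
    · have := hp' v (List.mem_of_mem_tail hv); omega
  · have := hm' v hv; omega

theorem Linked.direct_right (hxz : x ≤ z) (hzy : z ≤ y) (h₂ : Chainable A D z y)
    (h : Linked A x z 0 a b N) (hM : 2 ≤ M) (hM' : M ≤ y + 1 - z) :
    Direct A x y a b (N + M - 2) := by
  obtain ⟨l, m, hl, hm, hlm, hl', hm', hN⟩ := h
  obtain ⟨p, hp, hp', hpl⟩ := h₂.hub M hM hM'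
  have hz := hl.right_mem
  have h0 := hm.left_mem
  have hlen := hp.length_glue (l := l)
  have hlen' := hm.length_glue (l := l ++ p.tail)
  refine ⟨(l ++ p.tail) ++ m.tail, (hl.glue hp fun v hv hv' => ?_).glue hm fun v hv hv' => ?_,
    fun v hv => ?_, by omega⟩
  · have := hl' v hv
    have := hp' v hv'
    have : v ≠ 0 := by rintro rfl; exact hlm _ hv h0
    omega
  · rcases List.mem_append.1 hv with hv | hv
    · exact absurd hv' (hlm v hv)
    · have := hp' v (List.mem_of_mem_tail hv)
      have := hm' v hv'
      have : v ≠ z := by rintro rfl; exact hlm _ hz hv'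
      omega
  · rcases List.mem_append.1 hv with hv | hv
    · rcases List.mem_append.1 hv with hv | hv
      · have := hl' v hv; omega
      · have := hp' v (List.mem_of_mem_tail hv); omega
    · have := hm' v (List.mem_of_mem_tail hv); omega

theorem Linked.extend_left (hx : 1 ≤ x) (hxz : x ≤ z) (hzy : z ≤ y) (h₁ : Chainable A D x z)
    (h : Linked A z y z a b N) : Linked A x y x a b (N + (z - x)) := by
  obtain ⟨l, m, hl, hm, hlm, hl', hm', hN⟩ := h
  obtain ⟨p, hp, hp', hpl⟩ := h₁.rim
  have hz := hm.left_mem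
  have hlen := hm.length_glue (l := p)
  refine ⟨l, p ++ m.tail, hl, hp.glue hm fun v hv hv' => ?_, fun v hv hv' => ?_, fun v hv => ?_,
    fun v hv => ?_, by omega⟩
  · have := hp' v hv; have := hm' v hv'; omega
  · rcases List.mem_append.1 hv' with hv' | hv'
    · have := hl' v hv
      have := hp' v hv'
      obtain rfl : v = z := by omega
      exact hlm v hv hz
    · exact hlm v hv (List.mem_of_mem_tail hv')
  · have := hl' v hv; omega
  · rcases List.mem_append.1 hv with hv | hv
    · have := hp' v hv; omega
    · have := hm' v (List.mem_of_mem_tail hv); omega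

theorem Linked.cross_left (hxz : x ≤ z) (hzy : z ≤ y) (h₁ : Chainable A D x z)
    (h : Linked A z y 0 a b N) (hM : 2 ≤ M) (hM' : M ≤ z + 1 - x) :
    Linked A x y x a b (N + M - 1) := by
  obtain ⟨l, m, hl, hm, hlm, hl', hm', hN⟩ := h
  obtain ⟨p, hp, hp', hpl⟩ := h₁.hub M hM hM'
  have h0 := hm.left_mem
  have hlen := hm.length_glue (l := p)
  refine ⟨l, p ++ m.tail, hl, hp.glue hm fun v hv hv' => ?_, fun v hv hv' => ?_, fun v hv => ?_,
    fun v hv => ?_, by omega⟩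
  · have := hp' v hv; have := hm' v hv'; omega
  · rcases List.mem_append.1 hv' with hv' | hv'
    · have := hl' v hv
      have := hp' v hv'
      obtain rfl : v = 0 := by omega
      exact hlm _ hv h0
    · exact hlm v hv (List.mem_of_mem_tail hv')
  · have := hl' v hv; omega
  · rcases List.mem_append.1 hv with hv | hv
    · have := hp' v hv; omega
    · have := hm' v (List.mem_of_mem_tail hv); omega

theorem Chainable.union (hA : ∀ u v, A u v → A v u) (hx : 1 ≤ x) (hxz : x ≤ z) (hzy : z ≤ y)
    (h₁ : Chainable A D₁ x z) (h₂ : Chainable A D₂ z y) : Chainable A (D₁ ∪ D₂) x y where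
  rim := by
    obtain ⟨l, hl, hl', hll⟩ := h₁.rim
    obtain ⟨m, hm, hm', hml⟩ := h₂.rim
    have hlen := hm.length_glue (l := l)
    refine ⟨l ++ m.tail, hl.glue hm fun v hv hv' => ?_, fun v hv => ?_, by omega⟩
    · have := hl' v hv; have := hm' v hv'; omega
    · rcases List.mem_append.1 hv with hv | hv
      · have := hl' v hv; omega
      · have := hm' v (List.mem_of_mem_tail hv); omega
  hub N hN hN' := by
    by_cases hNz : N ≤ z + 1 - x
    · obtain ⟨l, hl, hl', hll⟩ := h₁.hub N hN hNz
      exact ⟨l, hl, fun v hv => by have := hl' v hv; omega, hll⟩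
    · obtain ⟨l, hl, hl', hll⟩ := h₁.rim
      obtain ⟨m, hm, hm', hml⟩ := h₂.hub (N - (z - x)) (by omega) (by omega)
      have hlen := hm.length_glue (l := l)
      refine ⟨l ++ m.tail, hl.glue hm fun v hv hv' => ?_, fun v hv => ?_, by omega⟩
      · have := hl' v hv; have := hm' v hv'; omega
      · rcases List.mem_append.1 hv with hv | hv
        · have := hl' v hv; omega
        · have := hm' v (List.mem_of_mem_tail hv); omega
  edge e he := by
    rcases Finset.mem_union.1 he with he | he
    · obtain ⟨R, hR, hd, hc⟩ := h₁.edge e he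
      refine ⟨R + (y - z), hR.imp (·.extend_right hx hxz hzy h₂) (·.extend_right hx hxz hzy h₂),
        fun N hN hN' => ?_, fun N hN hN' => ?_⟩
      · by_cases hNR : N < R
        · exact (hd N hN hNR).mono le_rfl hzy
        · have hNM : N = R + (N - R + 2) - 2 := by omega
          rw [hNM]
          rcases hR with hR | hR
          · exact hR.direct_right hxz hzy h₂ (by omega) (by omega)
          · exact (hR.direct_right hxz hzy h₂ (by omega) (by omega)).symm hA
      · have := hc (N - (y - z)) (by omega) (by omega)
        have hNM : N = N - (y - z) + (y - z) := by omega
        rw [hNM]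
        exact this.imp (·.extend_right hx hxz hzy h₂) (·.extend_right hx hxz hzy h₂)
    · obtain ⟨R, hR, hd, hc⟩ := h₂.edge e he
      refine ⟨R, hR.imp (·.mono hxz) (·.mono hxz), fun N hN hN' => (hd N hN hN').mono hxz le_rfl,
        fun N hN hN' => ?_⟩
      by_cases hNR : N ≤ R + (z - x)
      · have hNM : N = R + (N - R + 1) - 1 := by omega
        rw [hNM]
        exact hR.imp (·.cross_left hxz hzy h₁ (by omega) (by omega))
          (·.cross_left hxz hzy h₁ (by omega) (by omega))
      · have := hc (N - (z - x)) (by omega) (by omega)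
        have hNM : N = N - (z - x) + (z - x) := by omega
        rw [hNM]
        exact this.imp (·.extend_left hx hxz hzy h₁) (·.extend_left hx hxz hzy h₁)

/-- Translation of the rim by `c`, fixing the hub. -/
def shift (c v : ℕ) : ℕ := if v = 0 then 0 else v + c

theorem shift_injective (c : ℕ) : (shift c).Injective := by
  intro u v h
  unfold shift at h
  split_ifs at h <;> omega

theorem shift_zero (c : ℕ) : shift c 0 = 0 := rfl

theorem shift_of_pos (c : ℕ) {v : ℕ} (hv : 1 ≤ v) : shift c v = v + c := if_neg (by omega)

theorem shift_range {c v : ℕ} (h : v = 0 ∨ x ≤ v ∧ v ≤ y) :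
    shift c v = 0 ∨ x + c ≤ shift c v ∧ shift c v ≤ y + c := by
  unfold shift
  split_ifs <;> omega

theorem Linked.shift {c : ℕ} (hy : 1 ≤ y) (hAB : ∀ u v, A u v → B (shift c u) (shift c v))
    (h : Linked A x y s a b N) :
    Linked B (x + c) (y + c) (shift c s) (shift c a) (shift c b) N := by
  obtain ⟨l, m, hl, hm, hlm, hl', hm', hN⟩ := h
  refine ⟨l.map (BlockChain.shift c), m.map (BlockChain.shift c), ?_,
    hm.map (shift_injective c) hAB, ?_, ?_, ?_, by simpa using hN⟩
  · simpa [shift_of_pos c hy] using hl.map (shift_injective c) hAB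
  · simp only [List.mem_map, forall_exists_index, and_imp, forall_apply_eq_imp_iff₂, not_exists,
      not_and]
    intro v hv w hw h
    exact hlm v hv (shift_injective c h ▸ hw)
  · simpa using fun v hv => shift_range (hl' v hv)
  · simpa using fun v hv => shift_range (hm' v hv)

theorem Chainable.shift {c : ℕ} (hx : 1 ≤ x) (hxy : x ≤ y)
    (hAB : ∀ u v, A u v → B (shift c u) (shift c v)) (h : Chainable A D x y) :
    Chainable B (D.image fun e => (shift c e.1, shift c e.2)) (x + c) (y + c) where
  rim := by
    obtain ⟨l, hl, hl', hll⟩ := h.rim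
    refine ⟨l.map (BlockChain.shift c), ?_, ?_, by simp only [List.length_map]; omega⟩
    · simpa [shift_of_pos c hx, shift_of_pos c (hx.trans hxy)] using
        hl.map (shift_injective c) hAB
    · simp only [List.mem_map, forall_exists_index, and_imp, forall_apply_eq_imp_iff₂]
      intro v hv
      have := hl' v hv
      rw [shift_of_pos c (by omega)]
      omega
  hub N hN hN' := by
    obtain ⟨l, hl, hl', hll⟩ := h.hub N hN (by omega)
    refine ⟨l.map (BlockChain.shift c), ?_, ?_, by simpa using hll⟩
    · simpa [shift_of_pos c hx, shift_zero] using hl.map (shift_injective c) hAB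
    · simp only [List.mem_map, forall_exists_index, and_imp, forall_apply_eq_imp_iff₂]
      intro v hv
      have := hl' v hv
      unfold BlockChain.shift
      split_ifs <;> omega
  edge e he := by
    obtain ⟨e', he', rfl⟩ := Finset.mem_image.1 he
    obtain ⟨R, hR, hd, hc⟩ := h.edge e' he'
    refine ⟨R, hR.imp (·.shift (hx.trans hxy) hAB) (·.shift (hx.trans hxy) hAB),
      fun N hN hN' => ?_, fun N hN hN' => ?_⟩
    · obtain ⟨l, hl, hl', hll⟩ := hd N hN hN'
      exact ⟨l.map (BlockChain.shift c), hl.map (shift_injective c) hAB,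
        by simpa using fun v hv => shift_range (hl' v hv), by simpa using hll⟩
    · have := hc N hN (by omega)
      rw [← shift_of_pos c hx]
      exact this.imp (fun h => by simpa [shift_of_pos c hx] using h.shift (hx.trans hxy) hAB)
        (fun h => by simpa [shift_of_pos c hx] using h.shift (hx.trans hxy) hAB)

theorem Chainable.refl (A : ℕ → ℕ → Prop) (x : ℕ) : Chainable A ∅ x x where
  rim := ⟨[x], ⟨by simp, by simp, rfl, rfl⟩, by simp, by simp⟩
  hub N hN hN' := by omega
  edge e he := by simp at he

end Concatenation

section Soundness

variable {r : ℕ → ℕ → Bool} {keep : ℕ → Bool} {a u v x y x' y' N : ℕ} {l m p : List ℕ}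

theorem isChain_sound : ∀ {l : List ℕ}, isChain r l = true → l.IsChain fun u v => r u v = true
  | [], _ => .nil
  | [_], _ => .singleton _
  | x :: y :: t, h => by
    simp only [isChain, Bool.and_eq_true] at h
    exact List.isChain_cons_cons.2 ⟨h.1, isChain_sound h.2⟩

theorem distinct_sound : ∀ {l : List ℕ} {m : ℕ}, distinct m l = true →
    l.Nodup ∧ ∀ v ∈ l, m.testBit v = false
  | [], _, _ => by simp
  | x :: t, m, h => by
    simp only [distinct, Bool.cond_eq_ite, Bool.if_false_left, Bool.and_eq_true,
      Bool.not_eq_true'] at h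
    obtain ⟨hx, h⟩ := h
    obtain ⟨ht, hm⟩ := distinct_sound h
    simp only [Nat.testBit_or, Nat.testBit_two_pow, Bool.or_eq_false_iff,
      decide_eq_false_iff_not] at hm
    refine ⟨List.nodup_cons.2 ⟨fun hxt => (hm x hxt).2 rfl, ht⟩, fun v hv => ?_⟩
    rcases List.mem_cons.1 hv with rfl | hv
    · simpa using hx
    · exact (hm v hv).1

theorem hasEnds_sound (h : hasEnds u v l = true) : l.head? = some u ∧ l.getLast? = some v := by
  simpa [hasEnds] using h

theorem covers_sound {lo hi : ℕ} {is : List (ℕ × ℕ)} (h : covers lo hi is = true) {k : ℕ}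
    (hlo : lo ≤ k) (hhi : k ≤ hi) : ∃ i ∈ is, i.1 ≤ k ∧ k ≤ i.2 := by
  simp only [covers, List.all_eq_true, List.any_eq_true, List.mem_range'_1, Bool.and_eq_true,
    Nat.ble_eq] at h
  exact h k (by omega)

/-- `m` arises from `l` by bypassing one interior vertex. -/
def Bypass (r : ℕ → ℕ → Bool) (l m : List ℕ) : Prop :=
  m.Sublist l ∧ m.length + 1 = l.length ∧ m.head? = l.head? ∧ m.getLast? = l.getLast? ∧
    ((l.IsChain fun u v => r u v = true) → m.IsChain fun u v => r u v = true)

theorem Bypass.cons (v : ℕ) (h : Bypass r l m) : Bypass r (v :: l) (v :: m) := by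
  obtain ⟨h₁, h₂, h₃, h₄, h₅⟩ := h
  refine ⟨h₁.cons_cons v, by simpa using h₂, rfl, by simp [List.getLast?_cons, h₄], fun h => ?_⟩
  rw [List.isChain_cons] at h ⊢
  exact ⟨by rw [h₃]; exact h.1, h₅ h.2⟩

theorem bypass_push : ∀ l : List ℕ, Relation.ReflTransGen (Bypass r) (v :: l) (push r keep v l)
  | [] => .refl
  | [x] => .refl
  | x :: y :: t => by
    rw [push]
    cases h : !keep x && r v y
    · exact .refl
    · rw [Bool.and_eq_true] at h
      refine .head (b := v :: y :: t) ⟨?_, rfl, rfl, by simp [List.getLast?_cons], fun hc => ?_⟩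
        (bypass_push (y :: t))
      · exact ((List.Sublist.refl _).cons x).cons_cons v
      · simp only [List.isChain_cons_cons] at hc ⊢
        exact ⟨h.2, hc.2.2⟩

theorem bypass_prune : ∀ l : List ℕ, Relation.ReflTransGen (Bypass r) l (prune r keep l)
  | [] => .refl
  | v :: t => ((bypass_prune t).lift (v :: ·) fun _ _ => Bypass.cons v).trans (bypass_push _)

theorem exists_bypass (h : Relation.ReflTransGen (Bypass r) l m) (hm : m.length ≤ N)
    (hl : N ≤ l.length) : ∃ p, Relation.ReflTransGen (Bypass r) l p ∧ p.length = N := by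
  induction h with
  | refl => exact ⟨l, .refl, by omega⟩
  | @tail b c hb hbc ih =>
    by_cases hN : b.length ≤ N
    · exact ih hN
    · exact ⟨c, hb.tail hbc, by have := hbc.2.1; omega⟩

theorem PathList.bypass (h : Relation.ReflTransGen (Bypass r) l m)
    (hl : PathList (fun u v => r u v = true) x y l) :
    PathList (fun u v => r u v = true) x y m ∧ m ⊆ l := by
  induction h with
  | refl => exact ⟨hl, List.Subset.refl _⟩
  | tail hb hbc ih =>
    obtain ⟨h₁, h₂, h₃, h₄, h₅⟩ := hbc
    obtain ⟨⟨h₆, h₇, h₈, h₉⟩, h⟩ := ih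
    exact ⟨⟨h₅ h₆, h₇.sublist h₁, h₃.trans h₈, h₄.trans h₉⟩, fun v hv => h (h₁.subset hv)⟩

theorem PathList.exists_length (hl : PathList (fun u v => adj a u v = true) x y l)
    (hN : minLen a l ≤ N) (hN' : N ≤ l.length) :
    ∃ p, PathList (fun u v => adj a u v = true) x y p ∧ p ⊆ l ∧ p.length = N := by
  obtain ⟨p, hp, hpN⟩ := exists_bypass ((bypass_prune l).trans (bypass_prune _)) hN hN'
  exact ⟨p, (hl.bypass hp).1, (hl.bypass hp).2, hpN⟩

theorem minLen_le (a : ℕ) (l : List ℕ) : minLen a l ≤ l.length := by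
  have key : ∀ m, Relation.ReflTransGen (Bypass (adj a)) l m → m.length ≤ l.length := by
    intro m h
    induction h with
    | refl => rfl
    | tail _ hbc ih => have := hbc.2.1; omega
  exact key _ ((bypass_prune l).trans (bypass_prune _))

theorem adj_symm (a u v : ℕ) (h : adj a u v = true) : adj a v u = true := by
  rcases lt_trichotomy u v with huv | rfl | huv
  · simpa [adj, huv, huv.le, huv.not_gt] using h
  · exact h
  · simpa [adj, huv, huv.le, huv.not_gt] using h

theorem checkPair_sound (h : checkPair a x y x' y' l m = true) :
    PathList (fun u v => adj a u v = true) x y l ∧ PathList (fun u v => adj a u v = true) x' y' m ∧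
      (∀ v ∈ l, v ∉ m) ∧ (∀ v ∈ l, v ≤ a + 45) ∧ ∀ v ∈ m, v ≤ a + 45 := by
  simp only [checkPair, Bool.and_eq_true] at h
  obtain ⟨⟨⟨⟨⟨h₁, h₂⟩, h₃⟩, h₄⟩, h₅⟩, h₆⟩ := h
  obtain ⟨hl, hm, hlm⟩ := List.nodup_append.1 (distinct_sound h₅).1
  simp only [inBlock, List.all_eq_true, Nat.ble_eq, List.mem_append] at h₆
  exact ⟨⟨isChain_sound h₃, hl, hasEnds_sound h₁⟩, ⟨isChain_sound h₄, hm, hasEnds_sound h₂⟩,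
    fun v hv hv' => hlm v hv v hv' rfl, fun v hv => h₆ v (.inl hv), fun v hv => h₆ v (.inr hv)⟩

theorem checkPair_linked (h : checkPair a u (a + 45) x v l m = true)
    (hN : (intervalPair a l m).1 ≤ N) (hN' : N ≤ (intervalPair a l m).2) :
    Linked (fun u v => adj a u v = true) 1 (a + 45) x u v N := by
  obtain ⟨hl, hm, hlm, hl', hm'⟩ := checkPair_sound h
  have hml : minLen a l + minLen a m ≤ N := hN
  have hll : N ≤ l.length + m.length := hN'
  have hm₀ := minLen_le a m
  have hl₀ := minLen_le a l
  obtain ⟨p, hp, hpl, hpN⟩ := hl.exists_length (N := min l.length (N - minLen a m)) (by omega)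
    (by omega)
  obtain ⟨q, hq, hqm, hqN⟩ := hm.exists_length (N := N - min l.length (N - minLen a m)) (by omega)
    (by omega)
  refine ⟨p, q, hp, hq, fun v hv hv' => hlm v (hpl hv) (hqm hv'), fun v hv => ?_, fun v hv => ?_,
    by omega⟩
  · have := hl' v (hpl hv); omega
  · have := hm' v (hqm hv); omega

theorem checkDirect_direct (h : checkDirect a u v l = true) (hN : (interval a l).1 ≤ N)
    (hN' : N ≤ (interval a l).2) :
    Direct (fun u v => adj a u v = true) 1 (a + 45) u v N := by
  simp only [checkDirect, Bool.and_eq_true, Bool.or_eq_true, inBlock, List.all_eq_true,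
    Nat.ble_eq] at h
  obtain ⟨⟨⟨h₁, h₂⟩, h₃⟩, h₄⟩ := h
  have key : ∀ u v, hasEnds u v l = true →
      Direct (fun u v => adj a u v = true) 1 (a + 45) u v N := fun u v h₁ => by
    obtain ⟨p, hp, hpl, hpN⟩ := PathList.exists_length
      ⟨isChain_sound h₂, (distinct_sound h₃).1, hasEnds_sound h₁⟩ hN hN'
    exact ⟨p, hp, fun v hv => by have := h₄ v (hpl hv); omega, hpN⟩
  rcases h₁ with h₁ | h₁
  · exact key u v h₁
  · exact (key v u h₁).symm (adj_symm a)

end Soundness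

section Block

variable {A : ℕ → ℕ → Prop} {a u v x y s N : ℕ}

theorem mem_blockEdges :
    (u, v) ∈ blockEdges a ↔ u < v ∧ v ≤ a + 45 ∧ blockAdj a u v = true := by
  simp only [blockEdges, List.mem_flatMap, List.mem_range'_1, List.mem_map, List.mem_filter,
    Prod.mk.injEq, exists_eq_right_right]
  grind

theorem adj_cases (h : adj a u v = true) : (u, v) ∈ blockEdges a ∨ (v, u) ∈ blockEdges a ∨
    u = 0 ∧ v = a + 45 ∨ v = 0 ∧ u = a + 45 := by
  simp only [mem_blockEdges]
  rcases lt_trichotomy u v with huv | rfl | huv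
  · simp [adj, huv] at h
    tauto
  · simp [adj] at h
  · simp [adj, huv, huv.not_gt] at h
    tauto

theorem Linked.direct (hs : A y s) (h : Linked A x y s u v N) :
    Direct A x y u v N := by
  obtain ⟨l, m, hl, hm, hlm, hl', hm', hN⟩ := h
  refine ⟨l ++ m, hl.append hm hs hlm, fun v hv => ?_, by simpa using hN⟩
  exact (List.mem_append.1 hv).elim (hl' v) (hm' v)

theorem chainable_block (hrim : checkRim a = true) (hhub : checkHub a = true)
    (hedges : checkEdges a = true) :
    Chainable (fun u v => adj a u v = true) (blockEdges a).toFinset 1 (a + 45) where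
  rim := by
    simp only [checkRim, Bool.and_eq_true, beq_iff_eq, List.all_eq_true, Nat.ble_eq] at hrim
    obtain ⟨⟨⟨⟨h₁, h₂⟩, h₃⟩, h₄⟩, h₅⟩ := hrim
    exact ⟨_, ⟨isChain_sound h₁, (distinct_sound h₂).1, hasEnds_sound h₃⟩, h₅, by omega⟩
  hub N hN hN' := by
    simp only [checkHub, Bool.and_eq_true, List.all_eq_true, Nat.ble_eq] at hhub
    obtain ⟨i, hi, hiN, hiN'⟩ := covers_sound hhub.2 hN (by omega)
    obtain ⟨l, hl, rfl⟩ := List.mem_map.1 hi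
    obtain ⟨⟨⟨h₁, h₂⟩, h₃⟩, h₄⟩ := hhub.1 l hl
    obtain ⟨p, hp, hpl, hpN⟩ := PathList.exists_length
      ⟨isChain_sound h₁, (distinct_sound h₂).1, hasEnds_sound h₃⟩ hiN hiN'
    exact ⟨p, hp, fun v hv => by have := h₄ v (hpl hv); omega, hpN⟩
  edge e he := by
    obtain ⟨u, v⟩ := e
    have h := List.all_eq_true.1 hedges _ (List.mem_toFinset.1 he)
    simp only [checkCert, Bool.and_eq_true, Bool.or_eq_true] at h
    set c := cert a u v
    obtain ⟨⟨hpair, hdirect⟩, hcross⟩ := h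
    have hlinked : ∀ N, (intervalPair a c.toLast c.fromHub).1 ≤ N →
        N ≤ (intervalPair a c.toLast c.fromHub).2 →
        Linked (fun u v => adj a u v = true) 1 (a + 45) 0 u v N ∨
          Linked (fun u v => adj a u v = true) 1 (a + 45) 0 v u N := fun N hN hN' =>
      hpair.imp (checkPair_linked · hN hN') (checkPair_linked · hN hN')
    refine ⟨c.toLast.length + c.fromHub.length,
      hlinked _ (add_le_add (minLen_le _ _) (minLen_le _ _)) le_rfl, fun N hN hN' => ?_,
      fun N hN hN' => ?_⟩
    · obtain ⟨i, hi, hiN, hiN'⟩ := covers_sound hdirect hN (by omega)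
      rcases List.mem_cons.1 hi with rfl | hi
      · have hspoke : adj a (a + 45) 0 = true := by simp [adj]
        exact (hlinked N hiN hiN').elim (·.direct hspoke)
          fun h => (h.direct hspoke).symm (adj_symm a)
      · obtain ⟨l, hl, rfl⟩ := List.mem_map.1 hi
        exact checkDirect_direct (List.mem_filter.1 hl).2 hiN hiN'
    · obtain ⟨i, hi, hiN, hiN'⟩ := covers_sound hcross hN (by omega)
      obtain ⟨p, hp, rfl⟩ := List.mem_map.1 hi
      have := (List.mem_filter.1 hp).2
      simp only [Bool.or_eq_true] at this
      exact this.imp (checkPair_linked · hiN hiN') (checkPair_linked · hiN hiN')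

end Block

section Chain

/-- The length of the rim of a chain of blocks with the given parameters. -/
def span (ts : List ℕ) : ℕ := (ts.map (· + 44)).sum

/-- The edges of a chain of blocks whose rim begins at `c + 1`, without the last spoke. -/
def edges : List ℕ → ℕ → Finset (ℕ × ℕ)
  | [], _ => ∅
  | a :: ts, c =>
    (blockEdges a).toFinset.image (fun e => (shift c e.1, shift c e.2)) ∪ edges ts (c + (a + 44))

theorem span_cons (a : ℕ) (ts : List ℕ) : span (a :: ts) = a + 44 + span ts := by simp [span]

theorem chainable_block_seven :
    Chainable (fun u v => adj 7 u v = true) (blockEdges 7).toFinset 1 52 :=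
  chainable_block (by decide +kernel) (by decide +kernel) (by decide +kernel)

theorem chainable_block_eight :
    Chainable (fun u v => adj 8 u v = true) (blockEdges 8).toFinset 1 53 :=
  chainable_block (by decide +kernel) (by decide +kernel) (by decide +kernel)

theorem first_spoke_mem {a : ℕ} (ts : List ℕ) (c : ℕ) : (0, c + 1) ∈ edges (a :: ts) c := by
  refine Finset.mem_union_left _ (Finset.mem_image.2 ⟨(0, 1), ?_, ?_⟩)
  · rw [List.mem_toFinset, mem_blockEdges]
    simp [blockAdj]
  · simp [shift, add_comm]

theorem chainable_edges {A : ℕ → ℕ → Prop} (hA : ∀ u v, A u v → A v u) :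
    ∀ (ts : List ℕ) (c : ℕ), (∀ a ∈ ts, a = 7 ∨ a = 8) → (∀ e ∈ edges ts c, A e.1 e.2) →
      A 0 (c + 1 + span ts) → Chainable A (edges ts c) (c + 1) (c + 1 + span ts)
  | [], c, _, _, _ => Chainable.refl A _
  | a :: ts, c, hts, hedges, hspoke => by
    have hend : c + 1 + span (a :: ts) = c + (a + 44) + 1 + span ts := by
      rw [span_cons]; omega
    rw [hend] at hspoke ⊢
    have hblock : Chainable (fun u v => adj a u v = true) (blockEdges a).toFinset 1 (a + 45) := by
      rcases hts a List.mem_cons_self with rfl | rfl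
      · exact chainable_block_seven
      · exact chainable_block_eight
    have hlast : A 0 (c + (a + 45)) := by
      cases ts with
      | nil => exact hspoke
      | cons b ts => exact hedges _ (Finset.mem_union_right _ (first_spoke_mem ts (c + (a + 44))))
    have hmem : ∀ u v, (u, v) ∈ blockEdges a → A (shift c u) (shift c v) := fun u v h =>
      hedges (shift c u, shift c v) (Finset.mem_union_left _
        (Finset.mem_image.2 ⟨(u, v), List.mem_toFinset.2 h, rfl⟩))
    have hshift := hblock.shift (B := A) (c := c) le_rfl (by omega) fun u v h => by
      have hc : shift c (a + 45) = c + (a + 45) := by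
        rw [shift_of_pos c (by omega), add_comm]
      rcases adj_cases h with h | h | ⟨rfl, rfl⟩ | ⟨rfl, rfl⟩
      · exact hmem u v h
      · exact hA _ _ (hmem v u h)
      · rwa [hc]
      · rw [hc]
        exact hA _ _ hlast
    rw [add_comm 1 c, show a + 45 + c = c + (a + 44) + 1 by omega] at hshift
    exact hshift.union hA (by omega) (by omega) (by omega) (chainable_edges hA ts (c + (a + 44))
      (fun b hb => hts b (List.mem_cons_of_mem _ hb))
      (fun e he => hedges e (Finset.mem_union_right _ he)) hspoke)

theorem edges_lt : ∀ (ts : List ℕ) (c : ℕ), ∀ e ∈ edges ts c,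
    e.1 < e.2 ∧ e.2 ≤ c + 1 + span ts
  | [], _, _, he => by simp [edges] at he
  | a :: ts, c, e, he => by
    rw [span_cons]
    rcases Finset.mem_union.1 he with he | he
    · obtain ⟨⟨u, v⟩, h, rfl⟩ := Finset.mem_image.1 he
      obtain ⟨h₁, h₂, -⟩ := mem_blockEdges.1 (List.mem_toFinset.1 h)
      simp only [shift]
      split_ifs <;> omega
    · have := edges_lt ts _ e he
      omega

theorem card_edges_add_length_le : ∀ (ts : List ℕ) (c : ℕ), (∀ a ∈ ts, a = 7 ∨ a = 8) →
    (edges ts c).card + ts.length ≤ 2 * span ts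
  | [], _, _ => by simp [edges]
  | a :: ts, c, hts => by
    have ih := card_edges_add_length_le ts (c + (a + 44)) fun b hb =>
      hts b (List.mem_cons_of_mem _ hb)
    have hblock : (blockEdges a).length + 1 ≤ 2 * (a + 44) := by
      rcases hts a List.mem_cons_self with rfl | rfl <;> decide +kernel
    have h₁ := (Finset.card_image_le (s := (blockEdges a).toFinset)
      (f := fun e => (shift c e.1, shift c e.2))).trans (List.toFinset_card_le _)
    have h₂ := Finset.card_union_le ((blockEdges a).toFinset.image
      fun e => (shift c e.1, shift c e.2)) (edges ts (c + (a + 44)))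
    rw [span_cons, edges, List.length_cons]
    omega

/-- The edges of the chain of blocks together with the last spoke and the edge joining the ends of
the rim. -/
def closedEdges (ts : List ℕ) : Finset (ℕ × ℕ) :=
  insert (0, span ts + 1) (insert (1, span ts + 1) (edges ts 0))

theorem direct_of_mem_closedEdges {A : ℕ → ℕ → Prop} (hA : ∀ u v, A u v → A v u) {ts : List ℕ}
    (hts : ∀ a ∈ ts, a = 7 ∨ a = 8) (hspan : 1 ≤ span ts)
    (hedges : ∀ e ∈ closedEdges ts, A e.1 e.2) {N : ℕ} (hN : 3 ≤ N) (hN' : N ≤ span ts + 2)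
    {e : ℕ × ℕ} (he : e ∈ closedEdges ts) : Direct A 1 (span ts + 1) e.1 e.2 N := by
  have hspoke : A 0 (span ts + 1) := hedges (0, span ts + 1) (by simp [closedEdges])
  have hclose : A 1 (span ts + 1) := hedges (1, span ts + 1) (by simp [closedEdges])
  have hchain := chainable_edges hA ts 0 hts
    (fun e he => hedges e (by simp [closedEdges, he])) (by simpa [add_comm] using hspoke)
  rw [zero_add, add_comm 1 (span ts)] at hchain
  obtain ⟨l, hl, hl', hlN⟩ := hchain.hub (N - 1) (by omega) (by omega)
  have hlast : PathList A (span ts + 1) (span ts + 1) [span ts + 1] :=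
    ⟨by simp, by simp, rfl, rfl⟩
  simp only [closedEdges, Finset.mem_insert] at he
  rcases he with rfl | rfl | he
  · refine Direct.symm hA ⟨[span ts + 1] ++ l, hlast.append hl (hA _ _ hclose) ?_, ?_, ?_⟩
    · intro v hv hv'
      have := hl' v hv'
      simp at hv
      omega
    · intro v hv
      rcases List.mem_append.1 hv with hv | hv
      · simp at hv
        omega
      · have := hl' v hv
        omega
    · simp
      omega
  · refine ⟨l ++ [span ts + 1], hl.append hlast hspoke ?_, ?_, ?_⟩
    · intro v hv hv'
      have := hl' v hv
      simp at hv'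
      omega
    · intro v hv
      rcases List.mem_append.1 hv with hv | hv
      · have := hl' v hv
        omega
      · simp at hv
        omega
    · simp
      omega
  · obtain ⟨R, hR, hd, hc⟩ := hchain.edge e he
    rcases lt_trichotomy N R with hNR | rfl | hNR
    · exact hd N hN hNR
    · exact hR.elim (·.direct (hA _ _ hspoke)) fun h => (h.direct (hA _ _ hspoke)).symm hA
    · exact (hc N hNR (by omega)).elim (·.direct (hA _ _ hclose))
        fun h => (h.direct (hA _ _ hclose)).symm hA

end Chain

section Graph

theorem edgeInCycleOfLength_of_pathList {n : ℕ} {G : SimpleGraph (Fin n)} {A : ℕ → ℕ → Prop}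
    (hG : ∀ u v : Fin n, G.Adj u v ↔ A u v) {u v : Fin n} (huv : G.Adj u v) {l : List ℕ}
    (hl : PathList A u v l) (hn : ∀ w ∈ l, w < n) (hlen : 3 ≤ l.length) :
    G.EdgeInCycleOfLength s(u, v) l.length := by
  lift l to List (Fin n) using hn
  obtain ⟨h₁, h₂, h₃, h₄⟩ := hl
  rw [List.length_map] at hlen ⊢
  have hchain : l.IsChain G.Adj := by
    rw [List.isChain_map] at h₁
    exact h₁.imp fun u v => (hG u v).2
  have hne : l ≠ [] := by
    rintro rfl
    simp at hlen
  have hu : l.head hne = u := by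
    simpa [List.head?_eq_some_head hne, Fin.val_inj] using h₃
  have hv : l.getLast hne = v := by
    simpa [List.getLast?_eq_some_getLast hne, Fin.val_inj] using h₄
  subst hu hv
  have hpath : (SimpleGraph.Walk.ofSupport l hne hchain).IsPath := by
    rw [SimpleGraph.Walk.isPath_def, SimpleGraph.Walk.support_ofSupport]
    exact h₂.of_map _
  have hlength := SimpleGraph.Walk.length_ofSupport hne hchain
  refine ⟨_, .cons huv.symm (.ofSupport l hne hchain), ?_, ?_, ?_⟩
  · rw [SimpleGraph.Walk.cons_isCycle_iff, Sym2.eq_swap]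
    refine ⟨hpath, fun h => ?_⟩
    have := hpath.length_eq_one_of_mem_edges h
    omega
  · rw [SimpleGraph.Walk.length_cons]
    omega
  · rw [SimpleGraph.Walk.edges_cons, Sym2.eq_swap]
    exact List.mem_cons_self

theorem exists_edgePancyclic {ts : List ℕ} (hts : ∀ a ∈ ts, a = 7 ∨ a = 8) (hspan : 1 ≤ span ts) :
    ∃ G : SimpleGraph (Fin (span ts + 2)), G.EdgePancyclic ∧
      G.edgeSet.ncard + ts.length ≤ 2 * span ts + 2 := by
  let A : ℕ → ℕ → Prop := fun u v => (u, v) ∈ closedEdges ts ∨ (v, u) ∈ closedEdges ts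
  have hA : ∀ u v, A u v → A v u := fun u v => Or.symm
  have hlt : ∀ e ∈ closedEdges ts, e.1 < e.2 ∧ e.2 < span ts + 2 := by
    intro e he
    simp only [closedEdges, Finset.mem_insert] at he
    rcases he with rfl | rfl | he
    · simp
    · simp
      omega
    · have := edges_lt ts 0 e he
      omega
  let G : SimpleGraph (Fin (span ts + 2)) :=
    { Adj := fun u v => A u v
      symm := ⟨fun u v h => hA _ _ h⟩
      loopless := ⟨fun u h => by
        rcases h with h | h
        · exact (hlt _ h).1.false
        · exact (hlt _ h).1.false⟩ }
  refine ⟨G, fun k hk hkn e he => ?_, ?_⟩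
  · rw [Fintype.card_fin] at hkn
    induction e with
    | h u v =>
      have huv : G.Adj u v := he
      have hdirect : Direct A 1 (span ts + 1) u v k := by
        rcases huv with h | h
        · exact direct_of_mem_closedEdges hA hts hspan (fun _ => Or.inl) hk hkn h
        · exact (direct_of_mem_closedEdges hA hts hspan (fun _ => Or.inl) hk hkn h).symm hA
      obtain ⟨l, hl, hl', rfl⟩ := hdirect
      exact edgeInCycleOfLength_of_pathList (fun _ _ => Iff.rfl) huv hl
        (fun w hw => by have := hl' w hw; omega) hk
  · have hsub : G.edgeSet ⊆
        ((closedEdges ts).image fun e => s(Fin.ofNat (span ts + 2) e.1, Fin.ofNat _ e.2)) := by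
      intro e he
      induction e with
      | h u v =>
        have huv : A u v := he
        rw [Finset.mem_coe, Finset.mem_image]
        rcases huv with h | h
        · exact ⟨_, h, by simp⟩
        · exact ⟨_, h, by simp [Sym2.eq_swap]⟩
    have h₁ := Set.ncard_le_ncard hsub (Finset.finite_toSet _)
    rw [Set.ncard_coe_finset] at h₁
    have h₂ := Finset.card_image_le (s := closedEdges ts)
      (f := fun e => s(Fin.ofNat (span ts + 2) e.1, Fin.ofNat (span ts + 2) e.2))
    have h₃ := Finset.card_insert_le (0, span ts + 1) (insert (1, span ts + 1) (edges ts 0))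
    have h₄ := Finset.card_insert_le (1, span ts + 1) (edges ts 0)
    have h₅ := card_edges_add_length_le ts 0 hts
    have h₆ : (closedEdges ts).card =
      (insert (0, span ts + 1) (insert (1, span ts + 1) (edges ts 0))).card := rfl
    omega

theorem exists_span_eq {m : ℕ} (hm : 51 * 51 ≤ m) :
    ∃ ts : List ℕ, (∀ a ∈ ts, a = 7 ∨ a = 8) ∧ span ts = m ∧ ts.length = m / 51 := by
  refine ⟨List.replicate (m / 51 - m % 51) 7 ++ List.replicate (m % 51) 8, ?_, ?_, ?_⟩
  · intro a ha
    simp only [List.mem_append, List.mem_replicate] at ha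
    omega
  · simp only [span, List.map_append, List.map_replicate, List.sum_append, List.sum_replicate,
      smul_eq_mul]
    omega
  · simp only [List.length_append, List.length_replicate]
    omega

end Graph

end BlockChain

/-- for an integer `s ≥ e⁸`, with `ℓ = ⌈s / ln s⌉` and `n = (100s - 1)·s^ℓ`,
there exists an edge-pancyclic graph of order `n` with at most `2n - n/(200 ln n)` edges. -/
theorem statement_14 (s : ℕ) (hs : Real.exp 8 ≤ (s : ℝ))
    (ℓ : ℕ) (hℓ : (ℓ : ℤ) = ⌈(s : ℝ) / Real.log s⌉)
    (n : ℕ) (hn : n = (100 * s - 1) * s ^ ℓ) :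
    ∃ G : SimpleGraph (Fin n), G.EdgePancyclic ∧
      (G.edgeSet.ncard : ℝ) ≤ 2 * n - n / (200 * Real.log n) := by
  have hs' : 256 ≤ s := by
    have h1 : (2 : ℝ) ^ 8 ≤ Real.exp 1 ^ 8 := by
      gcongr
      linarith [Real.exp_one_gt_d9]
    rw [← Real.exp_nat_mul] at h1
    norm_num at h1
    exact_mod_cast h1.trans hs
  have hsn : 100 * s - 1 ≤ n := hn ▸ Nat.le_mul_of_pos_right _ (by positivity)
  have hlog : 8 ≤ Real.log n := by
    rw [Real.le_log_iff_exp_le (by norm_cast; omega)]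
    exact hs.trans (by norm_cast; omega)
  obtain ⟨ts, hts, hspan, hlength⟩ := BlockChain.exists_span_eq (m := n - 2) (by omega)
  have hex := BlockChain.exists_edgePancyclic hts (by omega)
  rw [show BlockChain.span ts + 2 = n by omega] at hex
  obtain ⟨G, hG, hcard⟩ := hex
  refine ⟨G, hG, ?_⟩
  have h₁ : 1600 * G.edgeSet.ncard + n ≤ 1600 * (2 * n) := by omega
  have h₂ : (n : ℝ) / (200 * Real.log n) ≤ n / 1600 := by
    gcongr
    linarith
  have h₃ : 1600 * (G.edgeSet.ncard : ℝ) + n ≤ 1600 * (2 * n) := by exact_mod_cast h₁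
  linarith
end

section
/- Let s ≥ 2 be an integer, ℓ = ⌊s/ln s⌋, and let G₁ be the graph on the vertex set {v_1, …, v_{s^ℓ}} (indices modulo s^ℓ) whose edge set is E₁ ∪ E₂, where E₁ is the edge set of the cycle v_1 v_2 … v_{s^ℓ} v_1 and E₂ consists of the edges v_{js} v_{js + s^i} for all j ∈ {1, …, s^{ℓ−1}} and i ∈ {1, …, ℓ−1}. Then for every edge e of G₁ and every integer p with 1 ≤ p ≤ ℓ − 1, there exists a cycle in G₁ containing e whose length lies in the interval [s^p − s^{p−1}, s^p + 3] and which uses at most 3 edges from E₂. -/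
namespace ZModChord

variable {N : ℕ} {G : SimpleGraph (ZMod N)}

lemma add_natCast_inj {a : ZMod N} {m n : ℕ} (hm : m < N) (hn : n < N)
    (h : a + (m : ZMod N) = a + (n : ZMod N)) : m = n := by
  have h' := (ZMod.natCast_eq_natCast_iff' m n N).1 (add_left_cancel h)
  rwa [Nat.mod_eq_of_lt hm, Nat.mod_eq_of_lt hn] at h'

/-- A chord of span `d`, with `2 ≤ d ≤ N / 2`, does not join consecutive residues. -/
lemma chord_ne_succ {a : ZMod N} {d : ℕ} (hd : 2 ≤ d) (hdN : 2 * d ≤ N) (x : ZMod N) :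
    s(a, a + (d : ZMod N)) ≠ s(x, x + 1) := by
  intro h
  rcases Sym2.eq_iff.1 h with ⟨rfl, h2⟩ | ⟨h1, rfl⟩
  · have := add_natCast_inj (a := a) (m := d) (n := 1) (by omega) (by omega) (by simpa using h2)
    omega
  · have := add_natCast_inj (a := a) (m := d + 1) (n := 0) (by omega) (by omega)
      (by push_cast; rw [add_zero, ← add_assoc]; exact h1.symm)
    omega

/-- The walk `a, a + 1, …, a + n` in a graph containing the cycle of consecutive residues. -/
lemma exists_arc (hG : ∀ x, G.Adj x (x + 1)) (a : ZMod N) (n : ℕ) (hn : n < N)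
    {b : ZMod N} (hb : a + (n : ZMod N) = b) :
    ∃ w : G.Walk a b, w.IsPath ∧ w.length = n ∧
      (∀ k < n, s(a + (k : ZMod N), a + (k : ZMod N) + 1) ∈ w.edges) ∧
      (∀ e ∈ w.edges, ∃ x, e = s(x, x + 1)) ∧
      (∀ v ∈ w.support, ∃ k ≤ n, v = a + (k : ZMod N)) := by
  induction n generalizing b with
  | zero =>
    refine ⟨SimpleGraph.Walk.nil.copy rfl (by simpa using hb), ?_⟩
    simp
  | succ n ih =>
    obtain ⟨w, hp, hl, hk, he, hv⟩ := ih (by omega) rfl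
    have hs : a + (n : ZMod N) + 1 = b := by rw [← hb]; push_cast; ring
    refine ⟨(w.concat (hG _)).copy rfl hs, ?_, ?_, ?_, ?_, ?_⟩
    · rw [SimpleGraph.Walk.isPath_copy]
      refine hp.concat (fun hmem => ?_) _
      rw [hs, ← hb] at hmem
      obtain ⟨k, hkn, hk'⟩ := hv _ hmem
      have := add_natCast_inj hn (by omega) hk'
      omega
    · simp [hl]
    · intro k hkn
      simp only [SimpleGraph.Walk.edges_copy, SimpleGraph.Walk.edges_concat, List.concat_eq_append,
        List.mem_append, List.mem_singleton]
      rcases Nat.lt_succ_iff_lt_or_eq.1 hkn with h | rfl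
      · exact Or.inl (hk k h)
      · exact Or.inr rfl
    · intro e hmem
      simp only [SimpleGraph.Walk.edges_copy, SimpleGraph.Walk.edges_concat, List.concat_eq_append,
        List.mem_append, List.mem_singleton] at hmem
      rcases hmem with h | h
      · exact he e h
      · exact ⟨_, h⟩
    · intro v hmem
      simp only [SimpleGraph.Walk.support_copy, SimpleGraph.Walk.support_concat,
        List.mem_append, List.mem_singleton] at hmem
      rcases hmem with h | h
      · obtain ⟨k, hkn, hk'⟩ := hv v h
        exact ⟨k, by omega, hk'⟩
      · exact ⟨n + 1, le_rfl, (h.trans hs).trans hb.symm⟩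

/-- The cycle closing an arc of length `d` by its chord. -/
lemma exists_cycle_one_chord (hG : ∀ x, G.Adj x (x + 1)) (a : ZMod N) {d : ℕ} (hd : 2 ≤ d)
    (hdN : 2 * d ≤ N) (h : G.Adj a (a + (d : ZMod N))) :
    ∃ (v : ZMod N) (c : G.Walk v v), c.IsCycle ∧ s(a, a + (d : ZMod N)) ∈ c.edges ∧
      (∀ k < d, s(a + (k : ZMod N), a + (k : ZMod N) + 1) ∈ c.edges) ∧ c.length = d + 1 ∧
      ∃ F : Finset (Sym2 (ZMod N)), F.card ≤ 3 ∧
        ∀ e ∈ c.edges, (∃ x, e = s(x, x + 1)) ∨ e ∈ F := by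
  obtain ⟨w, hp, hl, hk, he, -⟩ := exists_arc hG a d (by omega) rfl
  refine ⟨_, w.cons h.symm, ?_, ?_, ?_, ?_, {s(a, a + (d : ZMod N))}, by simp, ?_⟩
  · refine (SimpleGraph.Walk.cons_isCycle_iff _ _).2 ⟨hp, fun hmem => ?_⟩
    obtain ⟨x, hx⟩ := he _ hmem
    exact chord_ne_succ hd hdN x (Sym2.eq_swap.trans hx)
  · simp [Sym2.eq_swap]
  · intro k hkd
    simp [hk k hkd]
  · simp [hl]
  · intro e hmem
    rw [SimpleGraph.Walk.edges_cons, List.mem_cons] at hmem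
    rcases hmem with rfl | hmem
    · right; simp [Sym2.eq_swap]
    · exact Or.inl (he e hmem)

/-- The cycle made of two chords from `a`, of spans `m < d`, and the arc between their ends. -/
lemma exists_cycle_two_chords (hG : ∀ x, G.Adj x (x + 1)) (a : ZMod N) {m d : ℕ} (hm : 2 ≤ m)
    (hmd : m < d) (hdN : 2 * d ≤ N) (h : G.Adj a (a + (m : ZMod N)))
    (h' : G.Adj a (a + (d : ZMod N))) :
    ∃ (v : ZMod N) (c : G.Walk v v), c.IsCycle ∧ s(a, a + (m : ZMod N)) ∈ c.edges ∧
      c.length = d - m + 2 ∧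
      ∃ F : Finset (Sym2 (ZMod N)), F.card ≤ 3 ∧
        ∀ e ∈ c.edges, (∃ x, e = s(x, x + 1)) ∨ e ∈ F := by
  have hend : a + (m : ZMod N) + ((d - m : ℕ) : ZMod N) = a + (d : ZMod N) := by
    rw [Nat.cast_sub hmd.le]; ring
  obtain ⟨w, hp, hl, -, he, hv⟩ := exists_arc hG (a + (m : ZMod N)) (d - m) (by omega) hend
  have ha : a ∉ w.support := by
    intro hmem
    obtain ⟨k, hk, hk'⟩ := hv _ hmem
    have := add_natCast_inj (a := a) (m := 0) (n := m + k) (by omega) (by omega)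
      (by push_cast; rw [add_zero, ← add_assoc]; exact hk')
    omega
  refine ⟨_, (w.cons h).cons h'.symm, ?_, by simp, by simp [hl],
    {s(a, a + (m : ZMod N)), s(a, a + (d : ZMod N))}, Finset.card_le_two.trans (by omega), ?_⟩
  · refine (SimpleGraph.Walk.cons_isCycle_iff _ _).2
      ⟨(SimpleGraph.Walk.cons_isPath_iff _ _).2 ⟨hp, ha⟩, fun hmem => ?_⟩
    rw [SimpleGraph.Walk.edges_cons, List.mem_cons] at hmem
    rcases hmem with hmem | hmem
    · rw [Sym2.eq_swap, Sym2.congr_right] at hmem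
      have := add_natCast_inj (by omega) (by omega) hmem
      omega
    · obtain ⟨x, hx⟩ := he _ hmem
      exact chord_ne_succ (by omega) hdN x (Sym2.eq_swap.trans hx)
  · intro e hmem
    simp only [SimpleGraph.Walk.edges_cons, List.mem_cons] at hmem
    rcases hmem with rfl | rfl | hmem
    · right; simp [Sym2.eq_swap]
    · right; simp
    · exact Or.inl (he e hmem)

/-- The cycle made of an arc of length `d` from `a`, the chords of span `m > d` from both of its
ends, and the chord of span `d` from `a + m`. -/
lemma exists_cycle_three_chords (hG : ∀ x, G.Adj x (x + 1)) (a : ZMod N) {m d : ℕ} (hd : 2 ≤ d)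
    (hdm : d < m) (hmN : 2 * m ≤ N) (h₁ : G.Adj a (a + (m : ZMod N)))
    (h₂ : G.Adj (a + (d : ZMod N)) (a + (d : ZMod N) + (m : ZMod N)))
    (h₃ : G.Adj (a + (m : ZMod N)) (a + (m : ZMod N) + (d : ZMod N))) :
    ∃ (v : ZMod N) (c : G.Walk v v), c.IsCycle ∧ s(a, a + (m : ZMod N)) ∈ c.edges ∧
      c.length = d + 3 ∧
      ∃ F : Finset (Sym2 (ZMod N)), F.card ≤ 3 ∧
        ∀ e ∈ c.edges, (∃ x, e = s(x, x + 1)) ∨ e ∈ F := by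
  obtain ⟨w, hp, hl, -, he, hv⟩ := exists_arc hG a d (by omega) rfl
  rw [add_right_comm] at h₃
  have hc : a + (d : ZMod N) + (m : ZMod N) ∉ w.support := by
    intro hmem
    obtain ⟨k, hk, hk'⟩ := hv _ hmem
    have := add_natCast_inj (a := a) (m := d + m) (n := k) (by omega) (by omega)
      (by push_cast; rw [← add_assoc]; exact hk')
    omega
  have hb : a + (m : ZMod N) ∉ (w.concat h₂).support := by
    intro hmem
    simp only [SimpleGraph.Walk.support_concat, List.mem_append, List.mem_singleton] at hmem
    rcases hmem with hmem | hmem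
    · obtain ⟨k, hk, hk'⟩ := hv _ hmem
      have := add_natCast_inj (by omega) (by omega) hk'
      omega
    · have := add_natCast_inj (a := a) (m := m) (n := d + m) (by omega) (by omega)
        (by push_cast; rw [← add_assoc]; exact hmem)
      omega
  refine ⟨_, ((w.concat h₂).cons h₁.symm).cons h₃.symm, ?_, by simp [Sym2.eq_swap], by simp [hl],
    {s(a + (d : ZMod N) + (m : ZMod N), a + (m : ZMod N)), s(a + (m : ZMod N), a),
      s(a + (d : ZMod N), a + (d : ZMod N) + (m : ZMod N))}, Finset.card_le_three, ?_⟩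
  · refine (SimpleGraph.Walk.cons_isCycle_iff _ _).2
      ⟨(SimpleGraph.Walk.cons_isPath_iff _ _).2 ⟨hp.concat hc _, hb⟩, fun hmem => ?_⟩
    rw [SimpleGraph.Walk.edges_cons, List.mem_cons] at hmem
    rcases hmem with hmem | hmem
    · rw [Sym2.eq_swap, Sym2.congr_right] at hmem
      exact hc (by rw [hmem]; exact w.start_mem_support)
    · exact hb (SimpleGraph.Walk.snd_mem_support_of_mem_edges _ hmem)
  · intro e hmem
    simp only [SimpleGraph.Walk.edges_cons, SimpleGraph.Walk.edges_concat, List.concat_eq_append,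
      List.mem_append, List.mem_cons, List.not_mem_nil, or_false] at hmem
    rcases hmem with rfl | rfl | hmem | rfl
    · right; simp
    · right; simp
    · exact Or.inl (he e hmem)
    · right; simp

end ZModChord

/-- Lemma 8 of the paper.  Let `s ≥ 2`, `ℓ = ⌊s / ln s⌋` and `N = s^ℓ`.
The vertex `v_m` of `G₁` is represented by the residue `m : ZMod N` (indices mod `N`).
`E₁` is the edge set of the cycle `v_1 v_2 … v_N v_1`, and `E₂` consists of the edges
`v_{js} v_{js + sⁱ}` for `j ∈ {1, …, s^{ℓ-1}}` and `i ∈ {1, …, ℓ-1}`.  Then every edge of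
`G₁ = (V, E₁ ∪ E₂)` lies, for each `1 ≤ p ≤ ℓ - 1`, in a cycle of length in
`[s^p - s^{p-1}, s^p + 3]` using at most `3` edges of `E₂`. -/
theorem statement_15 (s : ℕ) (hs : 2 ≤ s)
    (ℓ : ℕ) (hℓ : (ℓ : ℤ) = ⌊(s : ℝ) / Real.log s⌋)
    (N : ℕ) (hN : N = s ^ ℓ)
    (E1 E2 : Set (Sym2 (ZMod N)))
    (hE1 : E1 = {e | ∃ x : ZMod N, e = s(x, x + 1)})
    (hE2 : E2 = {e | ∃ j i : ℕ, 1 ≤ j ∧ j ≤ s ^ (ℓ - 1) ∧ 1 ≤ i ∧ i ≤ ℓ - 1 ∧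
      e = s(((j * s : ℕ) : ZMod N), ((j * s + s ^ i : ℕ) : ZMod N))})
    (G1 : SimpleGraph (ZMod N)) (hG1 : G1 = SimpleGraph.fromEdgeSet (E1 ∪ E2)) :
    ∀ e ∈ G1.edgeSet, ∀ p : ℕ, 1 ≤ p → p ≤ ℓ - 1 →
      ∃ (v : ZMod N) (c : G1.Walk v v), c.IsCycle ∧ e ∈ c.edges ∧
        s ^ p - s ^ (p - 1) ≤ c.length ∧ c.length ≤ s ^ p + 3 ∧
        {e' : Sym2 (ZMod N) | e' ∈ c.edges ∧ e' ∈ E2}.ncard ≤ 3 := by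
  have hs0 : 0 < s := by omega
  intro e he p hp1 hpl
  obtain ⟨q, rfl⟩ : ∃ q, ℓ = q + 1 := ⟨ℓ - 1, by omega⟩
  simp only [Nat.add_sub_cancel] at hE2 hpl
  have hNs : N = s ^ q * s := by rw [hN, pow_succ]
  have hspan : ∀ i, 1 ≤ i → i ≤ q → 2 ≤ s ^ i ∧ 2 * s ^ i ≤ N := by
    intro i hi1 hiq
    have h1 : s ^ i ≤ s ^ q := Nat.pow_le_pow_right hs0 hiq
    exact ⟨hs.trans (Nat.le_self_pow (by omega) s), by rw [hNs]; nlinarith⟩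
  have hN2 : 4 ≤ N := by have := hspan p hp1 hpl; omega
  have : NeZero N := ⟨by omega⟩
  have hG : ∀ x, G1.Adj x (x + 1) := by
    intro x
    rw [hG1, SimpleGraph.fromEdgeSet_adj]
    refine ⟨Or.inl (hE1 ▸ ⟨x, rfl⟩), fun h => ?_⟩
    have := ZModChord.add_natCast_inj (a := x) (m := 0) (n := 1) (by omega) (by omega)
      (by simpa using h)
    omega
  have hmemE2 : ∀ j i : ℕ, 1 ≤ i → i ≤ q →
      s(((j * s : ℕ) : ZMod N), ((j * s : ℕ) : ZMod N) + ((s ^ i : ℕ) : ZMod N)) ∈ E2 := by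
    intro j i hi1 hiq
    have hM : 0 < s ^ q := by positivity
    have hlt := Nat.mod_lt (j + (s ^ q - 1)) hM
    have hj : (((j + (s ^ q - 1)) % s ^ q + 1) * s : ℕ) ≡ j * s [MOD N] := by
      rw [hNs]
      refine Nat.ModEq.mul_right' s (((Nat.mod_modEq _ _).add_right 1).trans ?_)
      rw [show j + (s ^ q - 1) + 1 = j + s ^ q by omega]
      simp [Nat.ModEq]
    rw [hE2]
    refine ⟨(j + (s ^ q - 1)) % s ^ q + 1, i, Nat.succ_pos _, hlt, hi1, hiq, ?_⟩
    rw [Nat.cast_add (_ * s), (ZMod.natCast_eq_natCast_iff _ _ N).2 hj]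
  have hchord : ∀ j i : ℕ, 1 ≤ i → i ≤ q →
      G1.Adj ((j * s : ℕ) : ZMod N) (((j * s : ℕ) : ZMod N) + ((s ^ i : ℕ) : ZMod N)) := by
    intro j i hi1 hiq
    rw [hG1, SimpleGraph.fromEdgeSet_adj]
    refine ⟨Or.inr (hmemE2 j i hi1 hiq), fun h => ?_⟩
    have := hspan i hi1 hiq
    have := ZModChord.add_natCast_inj (a := ((j * s : ℕ) : ZMod N)) (m := 0) (n := s ^ i)
      (by omega) (by omega) (by rw [Nat.cast_zero, add_zero]; exact h)
    omega
  have hdisj : ∀ e' ∈ E2, ∀ x : ZMod N, e' ≠ s(x, x + 1) := by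
    intro e' he' x
    rw [hE2] at he'
    obtain ⟨j, i, -, -, hi1, hiq, rfl⟩ := he'
    rw [Nat.cast_add (j * s)]
    exact ZModChord.chord_ne_succ (hspan i hi1 hiq).1 (hspan i hi1 hiq).2 x
  have hcount : ∀ {v : ZMod N} (c : G1.Walk v v),
      (∃ F : Finset (Sym2 (ZMod N)), F.card ≤ 3 ∧
        ∀ e ∈ c.edges, (∃ x, e = s(x, x + 1)) ∨ e ∈ F) →
      {e' : Sym2 (ZMod N) | e' ∈ c.edges ∧ e' ∈ E2}.ncard ≤ 3 := by
    rintro v c ⟨F, hF, h⟩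
    refine le_trans ?_ hF
    rw [← Set.ncard_coe_finset F]
    refine Set.ncard_le_ncard (fun e' he' => ?_) F.finite_toSet
    rcases h e' he'.1 with ⟨x, hx⟩ | h'
    · exact absurd hx (hdisj e' he'.2 x)
    · exact h'
  obtain ⟨hp2, hpN⟩ := hspan p hp1 hpl
  rw [hG1, SimpleGraph.edgeSet_fromEdgeSet] at he
  rcases he.1 with he | he
  · rw [hE1] at he
    obtain ⟨x, rfl⟩ := he
    obtain ⟨v, c, hc, -, hk, hl, hF⟩ := ZModChord.exists_cycle_one_chord hG
      ((x.val / s * s : ℕ) : ZMod N) hp2 hpN (hchord _ p hp1 hpl)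
    refine ⟨v, c, hc, ?_, by omega, by omega, hcount c hF⟩
    have hx : ((x.val / s * s : ℕ) : ZMod N) + ((x.val % s : ℕ) : ZMod N) = x := by
      rw [← Nat.cast_add, Nat.div_add_mod', ZMod.natCast_zmod_val]
    have := hk (x.val % s) ((Nat.mod_lt _ hs0).trans_le (Nat.le_self_pow (by omega) s))
    rwa [hx] at this
  · rw [hE2] at he
    obtain ⟨j, i, -, -, hi1, hiq, rfl⟩ := he
    rw [Nat.cast_add (j * s)]
    obtain ⟨hi2, hiN⟩ := hspan i hi1 hiq
    rcases lt_trichotomy i p with hip | rfl | hip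
    · obtain ⟨v, c, hc, he, hl, hF⟩ := ZModChord.exists_cycle_two_chords hG _ hi2
        (Nat.pow_lt_pow_right hs hip) hpN (hchord j i hi1 hiq) (hchord j p hp1 hpl)
      have : s ^ i ≤ s ^ (p - 1) := Nat.pow_le_pow_right hs0 (by omega)
      exact ⟨v, c, hc, he, by omega, by omega, hcount c hF⟩
    · obtain ⟨v, c, hc, he, -, hl, hF⟩ := ZModChord.exists_cycle_one_chord hG _ hi2 hiN
        (hchord j i hi1 hiq)
      exact ⟨v, c, hc, he, by omega, by omega, hcount c hF⟩
    · have hshift : ∀ r, 1 ≤ r → ((j * s : ℕ) : ZMod N) + ((s ^ r : ℕ) : ZMod N) =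
          (((j + s ^ (r - 1)) * s : ℕ) : ZMod N) := by
        intro r hr
        rw [← Nat.cast_add, add_mul, ← pow_succ, Nat.sub_add_cancel hr]
      obtain ⟨v, c, hc, he, hl, hF⟩ := ZModChord.exists_cycle_three_chords hG _ hp2
        (Nat.pow_lt_pow_right hs hip) hiN (hchord j i hi1 hiq)
        (by rw [hshift p hp1]; exact hchord _ i hi1 hiq)
        (by rw [hshift i hi1]; exact hchord _ p hp1 hpl)
      exact ⟨v, c, hc, he, by omega, by omega, hcount c hF⟩
end

section
/- Let G be a simple graph of order n with minimum degree δ(G) ≥ 3 such that the set of vertices of degree exactly 3 forms an independent set (no two vertices of degree 3 are adjacent). Then the sum of the degrees of the vertices of G is at least 24n/7, and consequently e(G) ≥ ⌈12n/7⌉. -/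
/-- In a finite graph, the degrees over an independent set sum to at most the degrees over its
complement. -/
theorem SimpleGraph.IsIndepSet.sum_degree_le_sum_degree_compl {V : Type*} [Fintype V]
    [DecidableEq V] {G : SimpleGraph V} [DecidableRel G.Adj] {s : Finset V}
    (hs : G.IsIndepSet s) : ∑ v ∈ s, G.degree v ≤ ∑ v ∈ sᶜ, G.degree v := by
  calc ∑ v ∈ s, G.degree v
      = ∑ v ∈ s, (sᶜ.bipartiteAbove G.Adj v).card := by
        refine Finset.sum_congr rfl fun v hv => ?_
        rw [← G.card_neighborFinset_eq_degree]
        congr 1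
        ext w
        simp only [mem_neighborFinset, Finset.mem_bipartiteAbove, Finset.mem_compl]
        exact ⟨fun h => ⟨fun hw => hs hv hw h.ne h, h⟩, And.right⟩
    _ = ∑ v ∈ sᶜ, (s.bipartiteBelow G.Adj v).card :=
        Finset.sum_card_bipartiteAbove_eq_sum_card_bipartiteBelow G.Adj
    _ ≤ ∑ v ∈ sᶜ, G.degree v := by
        refine Finset.sum_le_sum fun v _ => ?_
        rw [← G.card_neighborFinset_eq_degree]
        refine Finset.card_le_card fun w hw => ?_
        simpa using ((Finset.mem_bipartiteBelow G.Adj).mp hw).2.symm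

/-- If every degree is at least `3` and the vertices of degree `3` are independent, then the
degree sum is at least `24 / 7` times the order. -/
theorem SimpleGraph.card_mul_le_sum_degree_of_isIndepSet {V : Type*} [Fintype V]
    {G : SimpleGraph V} [DecidableRel G.Adj] (hδ : ∀ v, 3 ≤ G.degree v)
    (hind : G.IsIndepSet {v | G.degree v = 3}) :
    24 * Fintype.card V ≤ 7 * ∑ v, G.degree v := by
  classical
  let s : Finset V := {v | G.degree v = 3}
  have hs : ∑ v ∈ s, G.degree v = s.card * 3 :=
    Finset.sum_const_nat fun v hv => (Finset.mem_filter.mp hv).2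
  have hsc : sᶜ.card * 4 ≤ ∑ v ∈ sᶜ, G.degree v := by
    rw [← smul_eq_mul]
    refine Finset.card_nsmul_le_sum _ (fun v => G.degree v) _ fun v hv => ?_
    have hv : G.degree v ≠ 3 := by simpa [s] using hv
    have := hδ v
    lia
  have hle : ∑ v ∈ s, G.degree v ≤ ∑ v ∈ sᶜ, G.degree v :=
    IsIndepSet.sum_degree_le_sum_degree_compl (by simpa [s] using hind)
  have hcard := s.card_add_card_compl
  have hsum := Finset.sum_add_sum_compl s fun v => G.degree v
  lia

/-- if `G` has minimum degree at least `3` and the vertices of degree exactly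
`3` form an independent set, then the degree sum is at least `24n/7`, and consequently
`e(G) ≥ ⌈12n/7⌉`. -/
theorem statement_16 {V : Type*} [Fintype V] (G : SimpleGraph V)
    (hδ : ∀ v : V, 3 ≤ (G.neighborSet v).ncard)
    (hind : ∀ u v : V, (G.neighborSet u).ncard = 3 → (G.neighborSet v).ncard = 3 →
      ¬G.Adj u v) :
    (24 * (Fintype.card V : ℚ)) / 7 ≤ ∑ v : V, ((G.neighborSet v).ncard : ℚ) ∧
    ⌈(12 * (Fintype.card V : ℚ)) / 7⌉ ≤ (G.edgeSet.ncard : ℤ) := by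
  classical
  have hdeg (v : V) : (G.neighborSet v).ncard = G.degree v := by
    rw [Set.ncard_eq_toFinset_card', SimpleGraph.degree, SimpleGraph.neighborFinset]
  have hedge : G.edgeSet.ncard = G.edgeFinset.card := by
    rw [Set.ncard_eq_toFinset_card', SimpleGraph.edgeFinset]
  simp only [hdeg] at hδ hind ⊢
  have hbound := SimpleGraph.card_mul_le_sum_degree_of_isIndepSet hδ
    fun u hu v hv _ => hind u v hu hv
  have htwice := G.sum_degrees_eq_twice_card_edges
  rw [hedge]
  constructor
  · rw [div_le_iff₀ (by norm_num), mul_comm _ (7 : ℚ)]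
    exact_mod_cast hbound
  · rw [Int.ceil_le, div_le_iff₀ (by norm_num)]
    have : 12 * Fintype.card V ≤ G.edgeFinset.card * 7 := by lia
    exact_mod_cast this
end
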